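/- Let m ≥ 0 and 2m ≤ l ≤ n. (a) The R-submodule I_{l,m} := V̄_{l,m}E_{l,m}B_{l−2m}V̄_{l,m}* of B_n^k(R) is a two-sided ideal of B_l: x·y ∈ I_{l,m} and y·x ∈ I_{l,m} for every x ∈ B_l and y ∈ I_{l,m}. (b) If moreover l ≥ 2m+2, then the R-span of all products v·E_{l,m}·b·e_{l−2m−1}·b'·(w)* with v, w ∈ V̄_{l,m} and b, b' ∈ B_{l−2m} is contained in I_{l,m+1}. -/

import Mathlib

/-!
Cyclotomic BMW algebra `B_n^k(R)`, presented as the quotient of the free `R`-algebra on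
generators `Y, Y⁻¹, Xᵢ, Xᵢ⁻¹ (1 ≤ i ≤ n-1), eᵢ (1 ≤ i ≤ n-1)` by the defining relations.
Generators with out-of-range indices are identified with `1` (resp. `0` for the `eᵢ`),
so that the quotient is exactly the cyclotomic BMW algebra.
-/

inductive BMWGen : Type
  | Y : BMWGen
  | Yinv : BMWGen
  | X : ℕ → BMWGen
  | Xinv : ℕ → BMWGen
  | E : ℕ → BMWGen

namespace CBMW

/-- The parameters of a cyclotomic BMW algebra: `n`, `k`, units `q, λ, q₀` and
families `qc` (the `qᵢ`, with `qc 0 = q₀`) and `A` (the `Aᵢ`). -/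
structure Params (R : Type) [CommRing R] where
  n : ℕ
  k : ℕ
  q : Rˣ
  lam : Rˣ
  q0 : Rˣ
  qc : ℕ → R
  A : ℕ → R

variable {R : Type} [CommRing R]

abbrev F (R : Type) [CommRing R] := FreeAlgebra R BMWGen

def fY : F R := FreeAlgebra.ι R BMWGen.Y
def fYi : F R := FreeAlgebra.ι R BMWGen.Yinv
def fX (i : ℕ) : F R := FreeAlgebra.ι R (BMWGen.X i)
def fXi (i : ℕ) : F R := FreeAlgebra.ι R (BMWGen.Xinv i)
def fE (i : ℕ) : F R := FreeAlgebra.ι R (BMWGen.E i)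

/-- `δ = q - q⁻¹`. -/
def Params.delta (P : Params R) : R := (P.q : R) - ((P.q⁻¹ : Rˣ) : R)

/-- `λ⁻¹` as an element of `R`. -/
def Params.laminv (P : Params R) : R := ((P.lam⁻¹ : Rˣ) : R)

/-- The defining relations of the cyclotomic BMW algebra. -/
inductive Rel (P : Params R) : F R → F R → Prop
  | X_inv_right {i : ℕ} (h1 : 1 ≤ i) (h2 : i ≤ P.n - 1) : Rel P (fX i * fXi i) 1
  | X_inv_left {i : ℕ} (h1 : 1 ≤ i) (h2 : i ≤ P.n - 1) : Rel P (fXi i * fX i) 1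
  | Y_inv_right : Rel P (fY * fYi) 1
  | Y_inv_left : Rel P (fYi * fY) 1
  | X_invalid {i : ℕ} (h : i = 0 ∨ P.n - 1 < i) : Rel P (fX i) 1
  | Xi_invalid {i : ℕ} (h : i = 0 ∨ P.n - 1 < i) : Rel P (fXi i) 1
  | E_invalid {i : ℕ} (h : i = 0 ∨ P.n - 1 < i) : Rel P (fE i) 0
  | skein {i : ℕ} (h1 : 1 ≤ i) (h2 : i ≤ P.n - 1) :
      Rel P (fX i - fXi i) (P.delta • ((1 : F R) - fE i))
  | XX_far {i j : ℕ} (h1 : 1 ≤ i) (h2 : i ≤ P.n - 1) (h3 : 1 ≤ j) (h4 : j ≤ P.n - 1)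
      (h : i + 2 ≤ j ∨ j + 2 ≤ i) : Rel P (fX i * fX j) (fX j * fX i)
  | braid {i : ℕ} (h1 : 1 ≤ i) (h2 : i + 1 ≤ P.n - 1) :
      Rel P (fX i * fX (i+1) * fX i) (fX (i+1) * fX i * fX (i+1))
  | XE_far {i j : ℕ} (h1 : 1 ≤ i) (h2 : i ≤ P.n - 1) (h3 : 1 ≤ j) (h4 : j ≤ P.n - 1)
      (h : i + 2 ≤ j ∨ j + 2 ≤ i) : Rel P (fX i * fE j) (fE j * fX i)
  | EE_far {i j : ℕ} (h1 : 1 ≤ i) (h2 : i ≤ P.n - 1) (h3 : 1 ≤ j) (h4 : j ≤ P.n - 1)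
      (h : i + 2 ≤ j ∨ j + 2 ≤ i) : Rel P (fE i * fE j) (fE j * fE i)
  | untwist_right {i : ℕ} (h1 : 1 ≤ i) (h2 : i ≤ P.n - 1) :
      Rel P (fX i * fE i) ((P.lam : R) • fE i)
  | untwist_left {i : ℕ} (h1 : 1 ≤ i) (h2 : i ≤ P.n - 1) :
      Rel P (fE i * fX i) ((P.lam : R) • fE i)
  | XXE {i j : ℕ} (h1 : 1 ≤ i) (h2 : i ≤ P.n - 1) (h3 : 1 ≤ j) (h4 : j ≤ P.n - 1)
      (h : j = i + 1 ∨ i = j + 1) : Rel P (fX i * fX j * fE i) (fE j * fE i)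
  | EXX {i j : ℕ} (h1 : 1 ≤ i) (h2 : i ≤ P.n - 1) (h3 : 1 ≤ j) (h4 : j ≤ P.n - 1)
      (h : j = i + 1 ∨ i = j + 1) : Rel P (fE j * fE i) (fE j * fX i * fX j)
  | EEE_up {i : ℕ} (h1 : 1 ≤ i) (h2 : i + 1 ≤ P.n - 1) :
      Rel P (fE i * fE (i+1) * fE i) (fE i)
  | EEE_down {i : ℕ} (h1 : 1 ≤ i) (h2 : i + 1 ≤ P.n - 1) :
      Rel P (fE (i+1) * fE i * fE (i+1)) (fE (i+1))
  | E_sq {i : ℕ} (h1 : 1 ≤ i) (h2 : i ≤ P.n - 1) : Rel P (fE i * fE i) (P.A 0 • fE i)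
  | cyclo : Rel P (fY ^ P.k) (∑ i ∈ Finset.range P.k, P.qc i • fY ^ i)
  | braidB (h : 2 ≤ P.n) :
      Rel P (fX 1 * fY * fX 1 * fY) (fY * fX 1 * fY * fX 1)
  | YX_comm {i : ℕ} (h1 : 2 ≤ i) (h2 : i ≤ P.n - 1) : Rel P (fY * fX i) (fX i * fY)
  | YE_comm {i : ℕ} (h1 : 2 ≤ i) (h2 : i ≤ P.n - 1) : Rel P (fY * fE i) (fE i * fY)
  | YXYE (h : 2 ≤ P.n) : Rel P (fY * fX 1 * fY * fE 1) (P.laminv • fE 1)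
  | EYXY (h : 2 ≤ P.n) : Rel P (fE 1 * (fY * fX 1 * fY)) (P.laminv • fE 1)
  | EYE {m : ℕ} (h : 2 ≤ P.n) (hm : m ≤ P.k - 1) :
      Rel P (fE 1 * fY ^ m * fE 1) (P.A m • fE 1)

/-- The cyclotomic BMW algebra `B_n^k(R)`. -/
abbrev Alg (P : Params R) := RingQuot (Rel P)

def pr (P : Params R) : F R →ₐ[R] Alg P := RingQuot.mkAlgHom R (Rel P)

/-- The generator `Y`. -/
def Yg (P : Params R) : Alg P := pr P fY
/-- The generator `Y⁻¹`. -/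
def Ygi (P : Params R) : Alg P := pr P fYi
/-- The generator `Xᵢ`. -/
def Xg (P : Params R) (i : ℕ) : Alg P := pr P (fX i)
/-- The generator `Xᵢ⁻¹`. -/
def Xgi (P : Params R) (i : ℕ) : Alg P := pr P (fXi i)
/-- The generator `eᵢ`. -/
def Eg (P : Params R) (i : ℕ) : Alg P := pr P (fE i)

/-- `X₁ X₂ ⋯ X_m`. -/
def upX (P : Params R) : ℕ → Alg P
  | 0 => 1
  | m + 1 => upX P m * Xg P (m + 1)

/-- `X_m ⋯ X₂ X₁`. -/
def downX (P : Params R) : ℕ → Alg P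
  | 0 => 1
  | m + 1 => Xg P (m + 1) * downX P m

/-- `X₁⁻¹ X₂⁻¹ ⋯ X_m⁻¹`. -/
def upXi (P : Params R) : ℕ → Alg P
  | 0 => 1
  | m + 1 => upXi P m * Xgi P (m + 1)

/-- `X_m⁻¹ ⋯ X₂⁻¹ X₁⁻¹`. -/
def downXi (P : Params R) : ℕ → Alg P
  | 0 => 1
  | m + 1 => Xgi P (m + 1) * downXi P m

/-- `Yᵢ' = X_{i-1} ⋯ X₁ Y X₁ ⋯ X_{i-1}`. -/
def Yp (P : Params R) (i : ℕ) : Alg P := downX P (i - 1) * Yg P * upX P (i - 1)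

/-- `(Yᵢ')⁻¹ = X_{i-1}⁻¹ ⋯ X₁⁻¹ Y⁻¹ X₁⁻¹ ⋯ X_{i-1}⁻¹`. -/
def YpInv (P : Params R) (i : ℕ) : Alg P := downXi P (i - 1) * Ygi P * upXi P (i - 1)

/-- `(Yᵢ')^p` for an integer exponent `p`. -/
def Ypow (P : Params R) (i : ℕ) (p : ℤ) : Alg P :=
  if 0 ≤ p then Yp P i ^ p.toNat else YpInv P i ^ (-p).toNat

/-- `Y^{s 1} (Y₂')^{s 2} ⋯ (Y_m')^{s m}`. -/
def YpowProd (P : Params R) (s : ℕ → ℤ) : ℕ → Alg P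
  | 0 => 1
  | m + 1 => YpowProd P s m * Ypow P (m + 1) (s (m + 1))

/-- The subalgebra `B_l` generated by `Y^{±1}, X₁^{±1}, …, X_{l-1}^{±1}, e₁, …, e_{l-1}`. -/
def Bsub (P : Params R) (l : ℕ) : Subalgebra R (Alg P) :=
  Algebra.adjoin R
    ({Yg P, Ygi P} ∪
      {x | ∃ i, 1 ≤ i ∧ i + 1 ≤ l ∧ (x = Xg P i ∨ x = Xgi P i ∨ x = Eg P i)})

/-- `α_{ijl}^p = (Yᵢ')^p Xᵢ ⋯ X_{j-1} e_j ⋯ e_l`. -/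
def alpha (P : Params R) (i j l : ℕ) (p : ℤ) : Alg P :=
  Ypow P i p * ((List.range' i (j - i)).map fun t => Xg P t).prod *
    ((List.range' j (l + 1 - j)).map fun t => Eg P t).prod

/-- The set `P = {⌊k/2⌋ - (k-1), …, ⌊k/2⌋}` of `k` consecutive integers. -/
def Pset (k : ℕ) : Set ℤ := {p | (↑(k / 2) : ℤ) - ((k : ℤ) - 1) ≤ p ∧ p ≤ (↑(k / 2) : ℤ)}

/-- `α_{i₁,j₁,l-1}^{s₁} ⋯ α_{i_m,j_m,l-2m+1}^{s_m}`. -/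
def alphaChain (P : Params R) (l : ℕ) (ii jj : ℕ → ℕ) (ss : ℕ → ℤ) : ℕ → Alg P
  | 0 => 1
  | m + 1 => alphaChain P l ii jj ss m *
      alpha P (ii (m + 1)) (jj (m + 1)) (l + 1 - 2 * (m + 1)) (ss (m + 1))

/-- `α_{i₁,j₁,l-2}^{s₁} ⋯ α_{i_m,j_m,l-2m}^{s_m}`. -/
def alphaChainBar (P : Params R) (l : ℕ) (ii jj : ℕ → ℕ) (ss : ℕ → ℤ) : ℕ → Alg P
  | 0 => 1
  | m + 1 => alphaChainBar P l ii jj ss m *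
      alpha P (ii (m + 1)) (jj (m + 1)) (l - 2 * (m + 1)) (ss (m + 1))

/-- `E_{l,m} = e_{l-1} e_{l-3} ⋯ e_{l-2m+1}`. -/
def Echain (P : Params R) (l : ℕ) : ℕ → Alg P
  | 0 => 1
  | m + 1 => Echain P l m * Eg P (l + 1 - 2 * (m + 1))

/-- The set `V_{l,m}^g`. -/
def Vg (P : Params R) (l m : ℕ) : Set (Alg P) :=
  {x | ∃ ii jj : ℕ → ℕ, ∃ ss : ℕ → ℤ,
    (∀ t, 1 ≤ t → t ≤ m →
      1 ≤ ii t ∧ ii t ≤ jj t ∧ jj t ≤ l + 1 - 2 * t ∧ ss t ∈ Pset P.k) ∧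
    x = alphaChain P l ii jj ss m}

/-- The set `V_{l,m}`. -/
def V (P : Params R) (l m : ℕ) : Set (Alg P) :=
  {x | ∃ ii jj : ℕ → ℕ, ∃ ss : ℕ → ℤ,
    (∀ t, 1 ≤ t → t ≤ m →
      1 ≤ ii t ∧ ii t ≤ jj t ∧ jj t ≤ l + 1 - 2 * t ∧ ss t ∈ Pset P.k) ∧
    (∀ t, 1 ≤ t → t + 1 ≤ m → ii (t + 1) < ii t) ∧
    x = alphaChain P l ii jj ss m}

/-- The set `V̄_{l,m}`. -/
def Vbar (P : Params R) (l m : ℕ) : Set (Alg P) :=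
  {x | ∃ ii jj : ℕ → ℕ, ∃ ss : ℕ → ℤ,
    (∀ t, 1 ≤ t → t ≤ m →
      1 ≤ ii t ∧ ii t ≤ jj t ∧ jj t ≤ l + 1 - 2 * t ∧ ss t ∈ Pset P.k) ∧
    (∀ t, 1 ≤ t → t + 1 ≤ m → ii (t + 1) < ii t) ∧
    x = alphaChainBar P l ii jj ss m}

end CBMW

open CBMW

namespace CBMW

section Local

variable {R A : Type*} [CommRing R] [Ring A] [Algebra R A]

/-- The relations satisfied by `x = Xᵢ`, `y = Yᵢ'`, `z = Yᵢ₊₁'` and `e = eᵢ`. -/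
structure LocalRel (δ : R) (lam : Rˣ) (x y z : Aˣ) (e : A) : Prop where
  skein : (x : A) - ↑x⁻¹ = δ • (1 - e)
  conj : x * y * x = z
  comm : Commute y z
  yze : (y : A) * z * e = e
  eyz : e * y * z = e
  xe : (x : A) * e = (lam : R) • e
  ex : e * x = (lam : R) • e

/-- `p` lies between `0` and `r`. -/
def Btw (r p : ℤ) : Prop := (0 ≤ p ∧ p ≤ r) ∨ (r ≤ p ∧ p ≤ 0)

theorem mul_mul_of_eq {M : Type*} [Semigroup M] {a b c : M} (h : a * b = c) (t : M) :
    a * (b * t) = c * t := by rw [← mul_assoc, h]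

theorem zpow_mul_eq_self {u : Aˣ} {e : A} (h : (u : A) * e = e) (p : ℤ) :
    ((u ^ p : Aˣ) : A) * e = e := by
  have hi : (↑u⁻¹ : A) * e = e := by
    conv_lhs => rw [← h]
    simp
  induction p with
  | zero => simp
  | succ p ih => rw [zpow_add_one, Units.val_mul, mul_assoc, h, ih]
  | pred p ih => rw [zpow_sub_one, Units.val_mul, mul_assoc, hi, ih]

theorem mul_zpow_eq_self {u : Aˣ} {e : A} (h : e * (u : A) = e) (p : ℤ) :
    e * ((u ^ p : Aˣ) : A) = e := by
  have hi : e * (↑u⁻¹ : A) = e := by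
    conv_lhs => rw [← h]
    simp
  induction p with
  | zero => simp
  | succ p ih => rw [zpow_add_one, Units.val_mul, ← mul_assoc, ih, h]
  | pred p ih => rw [zpow_sub_one, Units.val_mul, ← mul_assoc, ih, hi]

theorem coe_zpow_comm {u : Aˣ} {b : A} (h : Commute (u : A) b) (p : ℤ) :
    Commute ((u ^ p : Aˣ) : A) b :=
  (h.symm.units_zpow_right p).symm

theorem coe_zpow_mul (u : Aˣ) (p q : ℤ) (t : A) :
    ((u ^ p : Aˣ) : A) * (((u ^ q : Aˣ) : A) * t) = ((u ^ (p + q) : Aˣ) : A) * t := by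
  rw [zpow_add, Units.val_mul, mul_assoc]

theorem coe_mul_zpow (u : Aˣ) (p : ℤ) (t : A) :
    (u : A) * (((u ^ p : Aˣ) : A) * t) = ((u ^ (p + 1) : Aˣ) : A) * t := by
  rw [add_comm, zpow_one_add, Units.val_mul, mul_assoc]

namespace LocalRel

variable {δ : R} {lam : Rˣ} {x y z : Aˣ} {e : A}

section
variable (h : LocalRel δ lam x y z e)
include h

theorem x_eq : (x : A) = ↑x⁻¹ + δ • 1 - δ • e := by
  have := h.skein
  rw [smul_sub, sub_eq_iff_eq_add] at this
  rw [this]; abel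

theorem xi_eq : (↑x⁻¹ : A) = x - δ • 1 + δ • e := by
  rw [h.x_eq]; abel

theorem xi_e : (↑x⁻¹ : A) * e = ((lam⁻¹ : Rˣ) : R) • e := by
  have : (↑x⁻¹ : A) * ((x : A) * e) = e := by simp
  rw [h.xe, mul_smul_comm] at this
  conv_rhs => rw [← this]
  rw [smul_smul, Units.inv_mul, one_smul]

theorem e_xi : e * (↑x⁻¹ : A) = ((lam⁻¹ : Rˣ) : R) • e := by
  have : (e * (x : A)) * (↑x⁻¹ : A) = e := by simp
  rw [h.ex, smul_mul_assoc] at this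
  conv_rhs => rw [← this]
  rw [smul_smul, Units.inv_mul, one_smul]

theorem zpow_e (p : ℤ) : ((z ^ p : Aˣ) : A) * e = ((y ^ (-p) : Aˣ) : A) * e := by
  have h1 := zpow_mul_eq_self (u := y * z) (e := e) (by simpa using h.yze) p
  rw [h.comm.mul_zpow, Units.val_mul] at h1
  conv_rhs => rw [← h1]
  rw [mul_assoc, coe_zpow_mul]
  simp

theorem e_zpow (p : ℤ) : e * ((z ^ p : Aˣ) : A) = e * ((y ^ (-p) : Aˣ) : A) := by
  have h1 := mul_zpow_eq_self (u := y * z) (e := e) (by simpa [mul_assoc] using h.eyz) p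
  rw [h.comm.eq, h.comm.symm.mul_zpow, Units.val_mul] at h1
  conv_rhs => rw [← h1]
  rw [mul_assoc, mul_assoc, ← Units.val_mul, ← zpow_add]
  simp

theorem e_zpow_mul (p : ℤ) (t : A) :
    e * (((z ^ p : Aˣ) : A) * t) = e * (((y ^ (-p) : Aˣ) : A) * t) := by
  rw [← mul_assoc, h.e_zpow, mul_assoc]

theorem zpow_e_mul (p : ℤ) (t : A) :
    ((z ^ p : Aˣ) : A) * (e * t) = ((y ^ (-p) : Aˣ) : A) * (e * t) := by
  rw [← mul_assoc, h.zpow_e, mul_assoc]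

theorem symm : LocalRel (-δ) lam⁻¹ x⁻¹ y⁻¹ z⁻¹ e where
  skein := by
    rw [inv_inv, neg_smul, ← h.skein]; abel
  conj := by rw [← h.conj]; group
  comm := h.comm.inv_inv
  yze := by
    have := h.zpow_e (-1)
    simp only [zpow_neg, zpow_one, neg_neg] at this
    rw [mul_assoc, this]; simp
  eyz := by
    have := h.e_zpow (-1)
    simp only [zpow_neg, zpow_one, neg_neg] at this
    rw [mul_assoc, ← Units.val_mul, h.comm.inv_inv.eq, Units.val_mul, ← mul_assoc, this]; simp
  xe := h.xi_e
  ex := h.e_xi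

theorem x_mul_z : (x : A) * z = y * x + δ • (z : A) - δ • (e * z) := by
  have h1 : (↑x⁻¹ : A) * z = y * x := by
    rw [← Units.val_mul, ← Units.val_mul, ← h.conj]; congr 1; group
  rw [← h1]
  nth_rewrite 1 [h.x_eq]
  simp only [sub_mul, add_mul, smul_mul_assoc, one_mul]

theorem z_mul_x : (z : A) * x = x * y + δ • (z : A) - δ • (z * e) := by
  have h1 : (z : A) * ↑x⁻¹ = x * y := by
    rw [← Units.val_mul, ← Units.val_mul, ← h.conj]; congr 1; group
  rw [← h1]
  nth_rewrite 1 [h.x_eq]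
  simp only [mul_sub, mul_add, mul_smul_comm, mul_one]

theorem ypow_x_zpow_succ (a b : ℤ) (t : A) :
    ((y ^ a : Aˣ) : A) * (x * (((z ^ (b + 1) : Aˣ) : A) * t)) =
      ((y ^ (a + 1) : Aˣ) : A) * (x * (((z ^ b : Aˣ) : A) * t))
        + δ • (((y ^ a : Aˣ) : A) * (((z ^ (b + 1) : Aˣ) : A) * t))
        - δ • (((y ^ a : Aˣ) : A) * (e * (((y ^ (-(b + 1)) : Aˣ) : A) * t))) := by
  rw [← h.e_zpow_mul, ← coe_mul_zpow z, ← mul_assoc (x : A), h.x_mul_z, zpow_add_one,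
    Units.val_mul]
  simp only [sub_mul, add_mul, mul_sub, mul_add, smul_mul_assoc, mul_smul_comm, mul_assoc]

theorem zpow_succ_x (b : ℤ) (t : A) :
    ((z ^ (b + 1) : Aˣ) : A) * (x * t) =
      ((z ^ b : Aˣ) : A) * (x * (y * t))
        + δ • (((z ^ (b + 1) : Aˣ) : A) * t)
        - δ • (((y ^ (-(b + 1)) : Aˣ) : A) * (e * t)) := by
  rw [← h.zpow_e_mul, zpow_add_one, Units.val_mul, mul_assoc, ← mul_assoc (z : A), h.z_mul_x]
  simp only [sub_mul, add_mul, mul_sub, mul_add, smul_mul_assoc, mul_smul_comm, mul_assoc]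

theorem x_ypow_succ (b : ℤ) (t : A) :
    (x : A) * (((y ^ (b + 1) : Aˣ) : A) * t) =
      (z : A) * (x * (((y ^ b : Aˣ) : A) * t))
        - δ • ((z : A) * (((y ^ b : Aˣ) : A) * t))
        + δ • ((z : A) * (e * (((y ^ b : Aˣ) : A) * t))) := by
  have h1 : (x : A) * y = z * x - δ • (z : A) + δ • (z * e) := by rw [h.z_mul_x]; abel
  rw [← coe_mul_zpow y, ← mul_assoc (x : A), h1]
  simp only [sub_mul, add_mul, smul_mul_assoc, mul_assoc]

end

section
variable (h : LocalRel δ lam x y z e) {S : Submodule R A} {β : A}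
  (hβ : Commute (y : A) β) (hS : ∀ s ∈ S, ∀ p : ℤ, s * ((y ^ p : Aˣ) : A) ∈ S)

include h in
theorem x_mul_mem_iff {w : A} (hw : w ∈ S) (he : e * w ∈ S) :
    (x : A) * w ∈ S ↔ (↑x⁻¹ : A) * w ∈ S := by
  have h1 : (x : A) * w = ↑x⁻¹ * w + (δ • w - δ • (e * w)) := by
    rw [h.x_eq]
    simp only [sub_mul, add_mul, smul_mul_assoc, one_mul]
    abel
  rw [h1]
  exact S.add_mem_iff_left (S.sub_mem (S.smul_mem _ hw) (S.smul_mem _ he))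

include h hβ hS in
theorem ypow_x_zpow_mem (b : ℕ) : ∀ a : ℤ,
    (((y ^ (a + b) : Aˣ) : A) * (x * β) ∈ S) →
    (∀ c : ℕ, 1 ≤ c → c ≤ b → ((z ^ (c : ℤ) : Aˣ) : A) * β ∈ S) →
    (∀ c : ℕ, 1 ≤ c → c ≤ b → ((y ^ (a + b - c) : Aˣ) : A) * (e * β) ∈ S) →
    ((y ^ a : Aˣ) : A) * (x * (((z ^ (b : ℤ) : Aˣ) : A) * β)) ∈ S := by
  induction b with
  | zero => intro a h1 _ _; simpa using h1
  | succ b ih =>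
    intro a h1 h2 h3
    have hyz : Commute (((y ^ a : Aˣ) : A)) (((z ^ ((b : ℤ) + 1) : Aˣ) : A) * β) := by
      refine Commute.mul_right ?_ (coe_zpow_comm hβ a)
      have := (h.comm.zpow_zpow a (b + 1))
      rw [commute_iff_eq, ← Units.val_mul, this.eq, Units.val_mul]
    push_cast at h1 h2 h3 ⊢
    rw [h.ypow_x_zpow_succ]
    refine S.sub_mem (S.add_mem (ih (a + 1) ?_ ?_ ?_) (S.smul_mem _ ?_)) (S.smul_mem _ ?_)
    · convert h1 using 4; ring
    · exact fun c hc hc' => h2 c hc (by omega)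
    · intro c hc hc'
      convert h3 c hc (by omega) using 4
      ring
    · rw [hyz.eq]
      refine hS _ ?_ _
      have := h2 (b + 1) (by omega) le_rfl
      push_cast at this
      exact this
    · rw [(coe_zpow_comm hβ _).eq, ← mul_assoc e, ← mul_assoc]
      refine hS _ ?_ _
      have := h3 (b + 1) (by omega) le_rfl
      push_cast at this
      simpa using this

include h hβ hS in
theorem x_zpow_mem (r : ℤ)
    (h1 : ∀ p, Btw r p → ((y ^ p : Aˣ) : A) * (x * β) ∈ S)
    (h2 : ∀ p, Btw r p → ((z ^ p : Aˣ) : A) * β ∈ S)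
    (h3 : ∀ p, Btw r p → ((y ^ p : Aˣ) : A) * (e * β) ∈ S) :
    (x : A) * (((z ^ r : Aˣ) : A) * β) ∈ S ∧ e * (((z ^ r : Aˣ) : A) * β) ∈ S := by
  have he : e * (((z ^ r : Aˣ) : A) * β) ∈ S := by
    rw [h.e_zpow_mul, (coe_zpow_comm hβ _).eq, ← mul_assoc]
    refine hS _ ?_ _
    have := h3 0 (by unfold Btw; omega)
    simpa using this
  refine ⟨?_, he⟩
  rcases le_total 0 r with hr | hr
  · lift r to ℕ using hr
    have := h.ypow_x_zpow_mem hβ hS r 0 (by simpa using h1 r (by unfold Btw; omega))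
      (fun c _ hc => h2 c (by unfold Btw; omega)) (fun c hc hc' => h3 _ (by unfold Btw; omega))
    simpa using this
  · rw [h.x_mul_mem_iff (h2 r (by unfold Btw; omega)) he]
    obtain ⟨r, rfl⟩ : ∃ s : ℕ, r = -s := ⟨r.natAbs, by omega⟩
    have hr' : Btw (-(r : ℤ)) (-r) := by unfold Btw; omega
    have h4 : ((y ^ (-r : ℤ) : Aˣ) : A) * (↑x⁻¹ * β) ∈ S := by
      rw [h.xi_eq]
      simp only [sub_mul, add_mul, mul_sub, mul_add, smul_mul_assoc, mul_smul_comm, one_mul]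
      refine S.add_mem (S.sub_mem (h1 _ hr') (S.smul_mem _ ?_)) (S.smul_mem _ (h3 _ hr'))
      rw [(coe_zpow_comm hβ _).eq]
      refine hS _ ?_ _
      have := h2 0 (by unfold Btw; omega)
      simpa using this
    have := h.symm.ypow_x_zpow_mem (β := β) (S := S) (by simpa using coe_zpow_comm hβ (-1))
      (fun s hs p => by rw [inv_zpow']; exact hS s hs _) r 0 (by simpa [inv_zpow'] using h4)
      (fun c _ hc => by rw [inv_zpow']; exact h2 _ (by unfold Btw; omega))
      (fun c hc hc' => by rw [inv_zpow']; exact h3 _ (by unfold Btw; omega))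
    simpa [inv_zpow'] using this

include h hβ hS in
/-- For a positive exponent, applying `x⁻¹` does not produce the top power of `z`. -/
theorem xi_zpow_succ_mem (r : ℕ)
    (h1 : ((y ^ ((r : ℤ) + 1) : Aˣ) : A) * (x * β) ∈ S)
    (h2 : ∀ p : ℤ, 0 ≤ p → p ≤ r → ((z ^ p : Aˣ) : A) * β ∈ S)
    (h3 : ∀ p : ℤ, 0 ≤ p → p ≤ r → ((y ^ p : Aˣ) : A) * (e * β) ∈ S) :
    (↑x⁻¹ : A) * (((z ^ ((r : ℤ) + 1) : Aˣ) : A) * β) ∈ S := by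
  have h4 : (↑x⁻¹ : A) * z = y * x := by
    rw [← Units.val_mul, ← Units.val_mul, ← h.conj]; congr 1; group
  rw [← coe_mul_zpow, mul_mul_of_eq h4, mul_assoc]
  have := h.ypow_x_zpow_mem hβ hS r 1 (by rwa [add_comm])
      (fun c _ hc => h2 c (by omega) (by omega)) (fun c hc hc' => h3 _ (by omega) (by omega))
  simpa using this

include h hβ hS in
theorem ypow_e_ypow_x_mem (q : ℤ)
    (h3 : ((y ^ q : Aˣ) : A) * (e * β) ∈ S)
    (h4 : ∀ p : ℤ, ((y ^ q : Aˣ) : A) * (e * (((y ^ p : Aˣ) : A) * (e * β))) ∈ S) (r : ℤ) :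
    ((y ^ q : Aˣ) : A) * (e * (((y ^ r : Aˣ) : A) * (x * β))) ∈ S := by
  have key : ∀ r : ℤ, ((y ^ q : Aˣ) : A) * (e * (((y ^ (r + 1) : Aˣ) : A) * (x * β))) ∈ S ↔
      ((y ^ q : Aˣ) : A) * (e * (((y ^ r : Aˣ) : A) * (x * β))) ∈ S := by
    intro r
    have hh := h.zpow_succ_x (-(r + 1)) β
    have e1 : ((y ^ q : Aˣ) : A) * (e * (((y ^ r : Aˣ) : A) * (x * β))) =
      (((y ^ q : Aˣ) : A) * (e * (((y ^ (r + 1) : Aˣ) : A) * (x * β)))) * y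
        + (δ • ((((y ^ q : Aˣ) : A) * (e * β)) * ((y ^ r : Aˣ) : A))
        - δ • (((y ^ q : Aˣ) : A) * (e * (((y ^ r : Aˣ) : A) * (e * β))))) := by
      have t : -(r + 1) + 1 = -r := by ring
      have hc := (coe_zpow_comm hβ r).eq
      rw [t, neg_neg] at hh
      have hh' := congrArg (fun t => ((y ^ q : Aˣ) : A) * (e * t)) hh
      simp only [mul_add, mul_sub, mul_smul_comm, h.e_zpow_mul, neg_neg] at hh'
      rw [hh']
      simp only [mul_assoc, hc, hβ.eq]
      abel
    rw [e1]
    refine Iff.trans ?_ (S.add_mem_iff_left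
      (S.sub_mem (S.smul_mem _ (hS _ h3 _)) (S.smul_mem _ (h4 _)))).symm
    constructor
    · intro hm
      simpa using hS _ hm 1
    · intro hm
      have := hS _ hm (-1)
      simpa [mul_assoc] using this
  have h0 : ((y ^ q : Aˣ) : A) * (e * (((y ^ (0 : ℤ) : Aˣ) : A) * (x * β))) ∈ S := by
    have : ((y ^ q : Aˣ) : A) * (e * (((y ^ (0 : ℤ) : Aˣ) : A) * (x * β))) =
      (lam : R) • (((y ^ q : Aˣ) : A) * (e * β)) := by
      simp only [zpow_zero, Units.val_one, one_mul]
      rw [← mul_assoc e, h.ex]; simp only [smul_mul_assoc, mul_smul_comm]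
    rw [this]
    exact S.smul_mem _ h3
  induction r with
  | zero => exact h0
  | succ r ih => exact (key _).2 ih
  | pred r ih => exact (key _).1 (by simpa using ih)

include h hβ hS in
theorem ypow_zpow_x_mem (b : ℕ) (c : ℤ)
    (h1 : ((y ^ c : Aˣ) : A) * (x * β) ∈ S)
    (h2 : ∀ p : ℕ, 1 ≤ p → p ≤ b → ((z ^ (p : ℤ) : Aˣ) : A) * β ∈ S)
    (h3 : ∀ p : ℕ, 1 ≤ p → p ≤ b → ((y ^ (c - p) : Aˣ) : A) * (e * β) ∈ S) :
    ((y ^ c : Aˣ) : A) * (((z ^ (b : ℤ) : Aˣ) : A) * (x * β)) ∈ S := by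
  induction b with
  | zero => simpa using h1
  | succ b ih =>
    have hyz : Commute (((y ^ c : Aˣ) : A)) (((z ^ ((b : ℤ) + 1) : Aˣ) : A) * β) := by
      refine Commute.mul_right ?_ (coe_zpow_comm hβ c)
      have := (h.comm.zpow_zpow c (b + 1))
      rw [commute_iff_eq, ← Units.val_mul, this.eq, Units.val_mul]
    have e2 := h2 (b + 1) (by omega) le_rfl
    have e3 := h3 (b + 1) (by omega) le_rfl
    push_cast at e2 e3 ⊢
    rw [h.zpow_succ_x]
    simp only [mul_add, mul_sub, mul_smul_comm]
    refine S.sub_mem (S.add_mem ?_ (S.smul_mem _ ?_)) (S.smul_mem _ ?_)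
    · rw [hβ.eq, ← mul_assoc (x : A), ← mul_assoc _ _ (y : A), ← mul_assoc _ _ (y : A)]
      simpa using hS _ (ih (fun p hp hp' => h2 p hp (by omega))
        (fun p hp hp' => h3 p hp (by omega))) 1
    · rw [hyz.eq]
      exact hS _ e2 _
    · rw [coe_zpow_mul]
      convert e3 using 4; ring

include h hβ hS in
theorem zpow_x_ypow_x_mem (r : ℕ)
    (h1 : ∀ p : ℤ, 0 ≤ p → p ≤ r → ((y ^ p : Aˣ) : A) * (x * β) ∈ S)
    (h2 : ∀ p : ℤ, 0 ≤ p → p ≤ r → ((z ^ p : Aˣ) : A) * β ∈ S)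
    (h3 : ∀ p : ℤ, |p| ≤ r → ((y ^ p : Aˣ) : A) * (e * β) ∈ S)
    (h4 : ∀ q p : ℤ, |q| ≤ r →
      ((y ^ q : Aˣ) : A) * (e * (((y ^ p : Aˣ) : A) * (e * β))) ∈ S) (b : ℕ) :
    ∀ a : ℕ, a + b + 1 = r →
      ((z ^ (a : ℤ) : Aˣ) : A) * (x * (((y ^ ((b : ℤ) + 1) : Aˣ) : A) * (x * β))) ∈ S := by
  induction b with
  | zero =>
    intro a ha
    have h5 : (x : A) * (y * (x * β)) = z * β := by
      rw [← h.conj]; simp [mul_assoc]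
    have := h2 (a + 1) (by omega) (by omega)
    simp only [CharP.cast_eq_zero, zero_add, zpow_one, h5]
    rwa [zpow_add_one, Units.val_mul, mul_assoc] at this
  | succ b ih =>
    intro a ha
    rw [h.x_ypow_succ]
    simp only [mul_add, mul_sub, mul_smul_comm]
    simp only [← mul_assoc _ (z : A), ← Units.val_mul, ← zpow_add_one]
    refine S.add_mem (S.sub_mem ?_ (S.smul_mem _ ?_)) (S.smul_mem _ ?_)
    · have := ih (a + 1) (by omega)
      push_cast at this ⊢
      exact this
    · have hyz : Commute (((z ^ ((a : ℤ) + 1) : Aˣ) : A))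
          ((y ^ (((b + 1 : ℕ) : ℤ)) : Aˣ) : A) := by
        have := (h.comm.zpow_zpow ((b + 1 : ℕ) : ℤ) (a + 1))
        rw [commute_iff_eq, ← Units.val_mul, ← this.eq, Units.val_mul]
      rw [← mul_assoc, hyz.eq, mul_assoc]
      have := h.ypow_zpow_x_mem hβ hS (a + 1) ((b + 1 : ℕ) : ℤ) (h1 _ (by omega) (by omega))
        (fun p hp hp' => h2 _ (by omega) (by omega)) (fun p hp hp' => h3 _ (by
          rw [abs_le]; omega))
      push_cast at this ⊢
      exact this
    · rw [h.zpow_e_mul]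
      refine h.ypow_e_ypow_x_mem hβ hS _ (h3 _ ?_) (fun p => h4 _ p ?_) _ <;>
      · rw [abs_le]; omega

include h in
theorem x_ypow_e_mem_of_nonneg (b : ℕ)
    (h3 : ∀ p : ℤ, |p| ≤ b → ((y ^ p : Aˣ) : A) * (e * β) ∈ S)
    (h4 : ∀ q p : ℤ, |q| ≤ b →
      ((y ^ q : Aˣ) : A) * (e * (((y ^ p : Aˣ) : A) * (e * β))) ∈ S) :
    (x : A) * (((y ^ (-b : ℤ) : Aˣ) : A) * (e * β)) ∈ S := by
  rw [← h.zpow_e_mul]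
  suffices ∀ c a : ℕ, a + c = b →
      ((y ^ (a : ℤ) : Aˣ) : A) * (x * (((z ^ (c : ℤ) : Aˣ) : A) * (e * β))) ∈ S by
    simpa using this b 0 (by omega)
  intro c
  induction c with
  | zero =>
    intro a ha
    have := S.smul_mem (lam : R) (h3 a (by rw [abs_le]; omega))
    simp only [CharP.cast_eq_zero, zpow_zero, Units.val_one, one_mul]
    rwa [mul_mul_of_eq h.xe, smul_mul_assoc, mul_smul_comm]
  | succ c ih =>
    intro a ha
    push_cast
    rw [h.ypow_x_zpow_succ]
    refine S.sub_mem (S.add_mem ?_ (S.smul_mem _ ?_)) (S.smul_mem _ (h4 _ _ ?_))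
    · have := ih (a + 1) (by omega)
      push_cast at this
      exact this
    · rw [h.zpow_e_mul, coe_zpow_mul]
      exact h3 _ (by rw [abs_le]; omega)
    · rw [abs_le]; omega

include h in
theorem x_ypow_e_mem (r : ℤ)
    (h3 : ∀ p : ℤ, |p| ≤ |r| → ((y ^ p : Aˣ) : A) * (e * β) ∈ S)
    (h4 : ∀ q p : ℤ, |q| ≤ |r| →
      ((y ^ q : Aˣ) : A) * (e * (((y ^ p : Aˣ) : A) * (e * β))) ∈ S) :
    (x : A) * (((y ^ r : Aˣ) : A) * (e * β)) ∈ S ∧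
      (↑x⁻¹ : A) * (((y ^ r : Aˣ) : A) * (e * β)) ∈ S ∧
      e * (((y ^ r : Aˣ) : A) * (e * β)) ∈ S := by
  have he : e * (((y ^ r : Aˣ) : A) * (e * β)) ∈ S := by
    have := h4 0 r (by simp)
    simpa using this
  have hi := h.x_mul_mem_iff (h3 r le_rfl) he
  rcases le_total r 0 with hr | hr
  · obtain ⟨r, rfl⟩ : ∃ s : ℕ, r = -s := ⟨r.natAbs, by omega⟩
    simp only [abs_neg, Nat.abs_cast] at h3 h4
    have := h.x_ypow_e_mem_of_nonneg r h3 h4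
    exact ⟨this, hi.1 this, he⟩
  · lift r to ℕ using hr
    simp only [Nat.abs_cast] at h3 h4
    have := h.symm.x_ypow_e_mem_of_nonneg (S := S) (β := β) r
      (fun p hp => by rw [inv_zpow']; exact h3 _ (by simpa using hp))
      (fun q p hq => by rw [inv_zpow', inv_zpow']; exact h4 _ _ (by simpa using hq))
    simp only [inv_zpow', neg_neg] at this
    exact ⟨hi.2 this, this, he⟩

include h hβ hS in
theorem x_ypow_x_mem (r : ℤ)
    (h1 : ∀ p, Btw r p → ((y ^ p : Aˣ) : A) * (x * β) ∈ S)
    (h2 : ∀ p, Btw r p → ((z ^ p : Aˣ) : A) * β ∈ S)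
    (h3 : ∀ p : ℤ, |p| ≤ |r| → ((y ^ p : Aˣ) : A) * (e * β) ∈ S)
    (h4 : ∀ q p : ℤ, |q| ≤ |r| →
      ((y ^ q : Aˣ) : A) * (e * (((y ^ p : Aˣ) : A) * (e * β))) ∈ S) :
    (x : A) * (((y ^ r : Aˣ) : A) * (x * β)) ∈ S ∧ e * (((y ^ r : Aˣ) : A) * (x * β)) ∈ S := by
  have hrr : Btw r r := by unfold Btw; omega
  have hr0 : Btw r 0 := by unfold Btw; omega
  have h10 : (x : A) * β ∈ S := by simpa using h1 0 hr0
  have h20 : β ∈ S := by simpa using h2 0 hr0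
  have h30 : e * β ∈ S := by simpa using h3 0 (by simp)
  have he : e * (((y ^ r : Aˣ) : A) * (x * β)) ∈ S := by
    have := h.ypow_e_ypow_x_mem hβ hS 0 (h3 0 (by simp)) (fun p => h4 0 p (by simp)) r
    simpa using this
  have hxi : (↑x⁻¹ : A) * β ∈ S := (h.x_mul_mem_iff h20 h30).1 h10
  have hyβ : ∀ p : ℤ, ((y ^ p : Aˣ) : A) * β ∈ S := fun p => by
    rw [(coe_zpow_comm hβ p).eq]; exact hS _ h20 p
  refine ⟨?_, he⟩
  rcases lt_trichotomy r 0 with hr | rfl | hr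
  · rw [h.x_mul_mem_iff (h1 r hrr) he]
    have e1 : (↑x⁻¹ : A) * (((y ^ r : Aˣ) : A) * (x * β)) =
        ↑x⁻¹ * (((y ^ r : Aˣ) : A) * (↑x⁻¹ * β)) + δ • ((↑x⁻¹ * β) * ((y ^ r : Aˣ) : A))
          - δ • (↑x⁻¹ * (((y ^ r : Aˣ) : A) * (e * β))) := by
      nth_rewrite 1 [h.x_eq]
      simp only [sub_mul, add_mul, mul_sub, mul_add, smul_mul_assoc, mul_smul_comm, one_mul,
        (coe_zpow_comm hβ r).eq, mul_assoc]
    rw [e1]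
    refine S.sub_mem (S.add_mem ?_ (S.smul_mem _ (hS _ hxi _)))
      (S.smul_mem _ (h.x_ypow_e_mem r h3 h4).2.1)
    obtain ⟨b, rfl⟩ : ∃ s : ℕ, r = -(s + 1 : ℕ) := ⟨r.natAbs - 1, by omega⟩
    simp only [abs_neg, Nat.abs_cast] at h3 h4
    have := h.symm.zpow_x_ypow_x_mem (S := S) (β := β) (by simpa using coe_zpow_comm hβ (-1))
      (fun s hs p => by rw [inv_zpow']; exact hS s hs _) (b + 1)
      (fun p hp hp' => by
        have hb : Btw (-((b + 1 : ℕ) : ℤ)) (-p) := by unfold Btw; omega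
        rw [inv_zpow', h.xi_eq]
        simp only [sub_mul, add_mul, mul_sub, mul_add, smul_mul_assoc, mul_smul_comm, one_mul]
        exact S.add_mem (S.sub_mem (h1 _ hb) (S.smul_mem _ (hyβ _)))
          (S.smul_mem _ (h3 _ (by rw [abs_le]; omega))))
      (fun p hp hp' => by rw [inv_zpow']; exact h2 _ (by unfold Btw; omega))
      (fun p hp => by rw [inv_zpow']; exact h3 _ (by simpa using hp))
      (fun q p hq => by rw [inv_zpow', inv_zpow']; exact h4 _ _ (by simpa using hq)) b 0 (by omega)
    simpa [inv_zpow'] using this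
  · have e1 : (x : A) * (((y ^ (0 : ℤ) : Aˣ) : A) * (x * β)) =
        β + δ • (x * β) - δ • ((lam : R) • (e * β)) := by
      simp only [zpow_zero, Units.val_one, one_mul]
      rw [← smul_mul_assoc (lam : R), ← h.ex]
      nth_rewrite 1 [h.x_eq]
      simp only [sub_mul, add_mul, smul_mul_assoc, one_mul, mul_assoc, Units.inv_mul_cancel_left]
    rw [e1]
    exact S.sub_mem (S.add_mem h20 (S.smul_mem _ h10)) (S.smul_mem _ (S.smul_mem _ h30))
  · obtain ⟨b, rfl⟩ : ∃ s : ℕ, r = (s + 1 : ℕ) := ⟨r.natAbs - 1, by omega⟩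
    simp only [Nat.abs_cast] at h3 h4
    have := h.zpow_x_ypow_x_mem hβ hS (b + 1) (fun p hp hp' => h1 _ (by unfold Btw; omega))
      (fun p hp hp' => h2 _ (by unfold Btw; omega)) h3 h4 b 0 (by omega)
    simpa using this

end

section
variable {f : A} {D : Subalgebra R A}

/-- If `e y^w e ∈ e D` for all `w`, then `f z^w f ∈ f D`, where `f` is the next `eᵢ`. -/
theorem f_zpow_f_mem_of_nonneg (h : LocalRel δ lam x y z e)
    (hD : ∀ p : ℤ, ((y ^ p : Aˣ) : A) ∈ D) (hf : ∀ d ∈ D, Commute f d)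
    (hfef : f * (e * f) = f) (hff : ∃ d ∈ D, f * f = f * d)
    (hfxf : f * (↑x⁻¹ * f) = (lam : R) • f)
    (hey : ∀ p : ℤ, ∃ d ∈ D, e * (((y ^ p : Aˣ) : A) * e) = e * d)
    (hfe : ∀ p : ℤ, f * (x * (((y ^ p : Aˣ) : A) * (↑x⁻¹ * f))) =
      f * (e * (((y ^ p : Aˣ) : A) * (e * f)))) (w : ℕ) :
    ∃ d ∈ D, f * (((z ^ (w : ℤ) : Aˣ) : A) * f) = f * d := by
  let T : Submodule R A := D.toSubmodule.map (LinearMap.mulLeft R f)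
  have hT : ∀ a, a ∈ T ↔ ∃ d ∈ D, a = f * d := fun a => by
    simp [T, Submodule.mem_map, eq_comm]
  have hTr : ∀ a ∈ T, ∀ d ∈ D, a * d ∈ T := by
    intro a ha d hd
    obtain ⟨c, hc, rfl⟩ := (hT a).1 ha
    exact (hT _).2 ⟨c * d, D.mul_mem hc hd, mul_assoc _ _ _⟩
  have hTl : ∀ a ∈ T, ∀ d ∈ D, d * a ∈ T := by
    intro a ha d hd
    obtain ⟨c, hc, rfl⟩ := (hT a).1 ha
    exact (hT _).2 ⟨d * c, D.mul_mem hd hc, by rw [← mul_assoc, ← (hf d hd).eq, mul_assoc]⟩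
  have hfT : f ∈ T := (hT f).2 ⟨1, D.one_mem, by simp⟩
  have hfy : ∀ p : ℤ, ∀ t, f * (((y ^ p : Aˣ) : A) * t) = ((y ^ p : Aˣ) : A) * (f * t) :=
    fun p t => by rw [← mul_assoc, (hf _ (hD p)).eq, mul_assoc]
  have hyf : ∀ p : ℤ, ((y ^ p : Aˣ) : A) * f = f * ((y ^ p : Aˣ) : A) :=
    fun p => (hf _ (hD p)).eq.symm
  have hy1 : (y : A) * f = f * y := by simpa using hyf 1
  have hyD : (y : A) ∈ D := by simpa using hD 1
  have feyef : ∀ p : ℤ, f * (e * (((y ^ p : Aˣ) : A) * (e * f))) ∈ T := by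
    intro p
    obtain ⟨d, hd, h1⟩ := hey p
    have : f * (e * (((y ^ p : Aˣ) : A) * (e * f))) = f * d := by
      have h2 := congrArg (fun t => f * (t * f)) h1
      simp only [mul_assoc] at h2
      rw [h2, ← (hf d hd).eq]
      simp only [← mul_assoc]
      rw [mul_assoc f e f, hfef]
    rw [this]
    exact (hT _).2 ⟨d, hd, rfl⟩
  have feyxf : ∀ b : ℕ, f * (e * (((y ^ (b : ℤ) : Aˣ) : A) * (↑x⁻¹ * f))) ∈ T := by
    intro b
    induction b with
    | zero =>
      simp only [CharP.cast_eq_zero, zpow_zero, Units.val_one, one_mul]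
      rw [← mul_assoc e, h.e_xi, smul_mul_assoc, mul_smul_comm, hfef]
      exact T.smul_mem _ hfT
    | succ b ih =>
      have h1 := h.symm.zpow_succ_x b f
      simp only [inv_zpow', neg_neg] at h1
      have h2 := congrArg (fun t => f * (e * t)) h1
      have hy1' : (↑y⁻¹ : A) * f = f * ↑y⁻¹ := by simpa using hyf (-1)
      simp only [mul_add, mul_sub, mul_smul_comm, h.e_zpow_mul, neg_neg, hyf, hy1'] at h2
      push_cast
      rw [h2]
      refine T.sub_mem (T.add_mem ?_ (T.smul_mem _ ?_)) (T.smul_mem _ (feyef _))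
      · have := hTr _ ih _ (hD (-1))
        simpa [mul_assoc] using this
      · rw [← mul_assoc e, ← mul_assoc f, hfef]
        exact hTr _ hfT _ (hD _)
  suffices f * (((z ^ (w : ℤ) : Aˣ) : A) * f) ∈ T from (hT _).1 this
  induction w using Nat.strong_induction_on with
  | _ w IH =>
  have fzxf : ∀ s : ℕ, s ≤ w → f * (((z ^ (s : ℤ) : Aˣ) : A) * (↑x⁻¹ * f)) ∈ T := by
    intro s
    induction s with
    | zero =>
      intro _
      simp only [CharP.cast_eq_zero, zpow_zero, Units.val_one, one_mul, hfxf]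
      exact T.smul_mem _ hfT
    | succ s ih =>
      intro hs
      have h1 : (z : A) * ↑x⁻¹ = x * y := by
        rw [← Units.val_mul, ← Units.val_mul, ← h.conj]; congr 1; group
      push_cast
      rw [zpow_add_one, Units.val_mul, mul_assoc _ (z : A), mul_mul_of_eq h1, mul_assoc, hy1,
        h.x_eq]
      simp only [add_mul, sub_mul, mul_add, mul_sub, smul_mul_assoc, mul_smul_comm, one_mul]
      refine T.sub_mem (T.add_mem ?_ (T.smul_mem _ ?_)) (T.smul_mem _ ?_)
      · simpa [mul_assoc] using hTr _ (ih (by omega)) _ hyD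
      · simpa [mul_assoc] using hTr _ (IH s (by omega)) _ hyD
      · rw [h.zpow_e_mul, hfy]
        have : f * (e * (f * (y : A))) = f * y := by
          conv_rhs => rw [← hfef]
          simp only [mul_assoc]
        rw [this]
        exact hTl _ (hTr _ hfT _ hyD) _ (hD _)
  rcases Nat.eq_zero_or_pos w with rfl | hw
  · obtain ⟨d, hd, h1⟩ := hff
    simp only [CharP.cast_eq_zero, zpow_zero, Units.val_one, one_mul, h1]
    exact (hT _).2 ⟨d, hd, rfl⟩
  have main : ∀ a b : ℕ, a + b = w →
      f * (((z ^ (a : ℤ) : Aˣ) : A) * (x * (((y ^ (b : ℤ) : Aˣ) : A) * (↑x⁻¹ * f)))) ∈ T := by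
    intro a
    induction a with
    | zero =>
      intro b hb
      simp only [CharP.cast_eq_zero, zpow_zero, Units.val_one, one_mul, hfe]
      exact feyef _
    | succ a ih =>
      intro b hb
      have h1 := ih (b + 1) (by omega)
      push_cast at h1 ⊢
      rw [h.x_ypow_succ] at h1
      simp only [mul_add, mul_sub, mul_smul_comm] at h1
      simp only [← mul_assoc _ (z : A), ← Units.val_mul, ← zpow_add_one] at h1
      have hyz : ((z ^ ((a : ℤ) + 1) : Aˣ) : A) * ((y ^ (b : ℤ) : Aˣ) : A) =
          ((y ^ (b : ℤ) : Aˣ) : A) * ((z ^ ((a : ℤ) + 1) : Aˣ) : A) := by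
        have := (h.comm.zpow_zpow b (a + 1))
        rw [← Units.val_mul, ← this.eq, Units.val_mul]
      have h2 : f * (((z ^ ((a : ℤ) + 1) : Aˣ) : A) *
          (((y ^ (b : ℤ) : Aˣ) : A) * (↑x⁻¹ * f))) ∈ T := by
        rw [mul_mul_of_eq hyz, mul_assoc, hfy]
        have := fzxf (a + 1) (by omega)
        push_cast at this
        exact hTl _ this _ (hD _)
      have h3 : f * (((z ^ ((a : ℤ) + 1) : Aˣ) : A) *
          (e * (((y ^ (b : ℤ) : Aˣ) : A) * (↑x⁻¹ * f)))) ∈ T := by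
        rw [h.zpow_e_mul, hfy]
        exact hTl _ (feyxf b) _ (hD _)
      rw [T.add_mem_iff_left (T.smul_mem _ h3), T.sub_mem_iff_left (T.smul_mem _ h2)] at h1
      exact h1
  simpa using main w 0 rfl

theorem f_zpow_f_mem (h : LocalRel δ lam x y z e)
    (hD : ∀ p : ℤ, ((y ^ p : Aˣ) : A) ∈ D) (hf : ∀ d ∈ D, Commute f d)
    (hfef : f * (e * f) = f) (hff : ∃ d ∈ D, f * f = f * d)
    (hfxf : f * (↑x⁻¹ * f) = (lam : R) • f) (hfxf' : f * (x * f) = ((lam⁻¹ : Rˣ) : R) • f)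
    (hey : ∀ p : ℤ, ∃ d ∈ D, e * (((y ^ p : Aˣ) : A) * e) = e * d)
    (hfe : ∀ p : ℤ, f * (x * (((y ^ p : Aˣ) : A) * (↑x⁻¹ * f))) =
      f * (e * (((y ^ p : Aˣ) : A) * (e * f))))
    (hfe' : ∀ p : ℤ, f * (↑x⁻¹ * (((y ^ p : Aˣ) : A) * (x * f))) =
      f * (e * (((y ^ p : Aˣ) : A) * (e * f)))) (w : ℤ) :
    ∃ d ∈ D, f * (((z ^ w : Aˣ) : A) * f) = f * d := by
  rcases le_total 0 w with hw | hw
  · lift w to ℕ using hw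
    exact h.f_zpow_f_mem_of_nonneg hD hf hfef hff hfxf hey hfe w
  · obtain ⟨w, rfl⟩ : ∃ s : ℕ, w = -s := ⟨w.natAbs, by omega⟩
    have := h.symm.f_zpow_f_mem_of_nonneg (D := D) (f := f)
      (fun p => by rw [inv_zpow']; exact hD _) hf hfef hff (by simpa using hfxf')
      (fun p => by rw [inv_zpow']; exact hey _)
      (fun p => by rw [inv_zpow', inv_inv]; exact hfe' _) w
    simpa [inv_zpow'] using this

end

end LocalRel
end Local
section Global

variable {R A : Type*} [CommRing R] [Ring A] [Algebra R A]

/-- Generators `Xᵢ`, `eᵢ`, `Y` of an algebra of BMW type. -/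
structure Gens (A : Type*) [Ring A] where
  X : ℕ → Aˣ
  E : ℕ → A
  y : Aˣ

namespace Gens

/-- The relations of the cyclotomic BMW algebra in the form in which they are used; `[-h, h']`
is the interval of exponents of `Y`. -/
structure IsBMW (D : Gens A) (N : ℕ) (δ : R) (lam : Rˣ) (h h' : ℤ) : Prop where
  h_nonneg : 0 ≤ h
  h_le : h ≤ h'
  le_h : h' ≤ h + 1
  skein : ∀ i, 1 ≤ i → i ≤ N → (D.X i : A) - ↑(D.X i)⁻¹ = δ • (1 - D.E i)
  XX_far : ∀ i j, 1 ≤ i → i + 2 ≤ j → j ≤ N → Commute (D.X i) (D.X j)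
  braid : ∀ i, 1 ≤ i → i + 1 ≤ N →
    D.X i * D.X (i + 1) * D.X i = D.X (i + 1) * D.X i * D.X (i + 1)
  XE_far : ∀ i j, 1 ≤ i → i + 2 ≤ j → j ≤ N → Commute (D.X i : A) (D.E j)
  EX_far : ∀ i j, 1 ≤ i → i + 2 ≤ j → j ≤ N → Commute (D.E i) (D.X j : A)
  EE_far : ∀ i j, 1 ≤ i → i + 2 ≤ j → j ≤ N → Commute (D.E i) (D.E j)
  XE : ∀ i, 1 ≤ i → i ≤ N → (D.X i : A) * D.E i = (lam : R) • D.E i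
  EX : ∀ i, 1 ≤ i → i ≤ N → D.E i * (D.X i : A) = (lam : R) • D.E i
  XXE_up : ∀ i, 1 ≤ i → i + 1 ≤ N →
    (D.X i : A) * (D.X (i + 1) * D.E i) = D.E (i + 1) * D.E i
  XXE_down : ∀ i, 1 ≤ i → i + 1 ≤ N →
    (D.X (i + 1) : A) * (D.X i * D.E (i + 1)) = D.E i * D.E (i + 1)
  EXX_up : ∀ i, 1 ≤ i → i + 1 ≤ N →
    D.E (i + 1) * ((D.X i : A) * D.X (i + 1)) = D.E (i + 1) * D.E i
  EXX_down : ∀ i, 1 ≤ i → i + 1 ≤ N →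
    D.E i * ((D.X (i + 1) : A) * D.X i) = D.E i * D.E (i + 1)
  EEE_up : ∀ i, 1 ≤ i → i + 1 ≤ N → D.E i * (D.E (i + 1) * D.E i) = D.E i
  EEE_down : ∀ i, 1 ≤ i → i + 1 ≤ N → D.E (i + 1) * (D.E i * D.E (i + 1)) = D.E (i + 1)
  EE : ∃ a : R, ∀ i, 1 ≤ i → i ≤ N → D.E i * D.E i = a • D.E i
  braidB : 1 ≤ N → D.X 1 * D.y * D.X 1 * D.y = D.y * D.X 1 * D.y * D.X 1
  yX : ∀ i, 2 ≤ i → i ≤ N → Commute D.y (D.X i)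
  yE : ∀ i, 2 ≤ i → i ≤ N → Commute (D.y : A) (D.E i)
  yXyE : 1 ≤ N → (D.y : A) * (D.X 1 * (D.y * D.E 1)) = ((lam⁻¹ : Rˣ) : R) • D.E 1
  EyXy : 1 ≤ N → D.E 1 * ((D.y : A) * (D.X 1 * D.y)) = ((lam⁻¹ : Rˣ) : R) • D.E 1
  EyE : 1 ≤ N → ∀ p : ℤ, ∃ a : R, D.E 1 * (((D.y ^ p : Aˣ) : A) * D.E 1) = a • D.E 1
  cyc : ∀ p : ℤ, ((D.y ^ p : Aˣ) : A) ∈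
    Submodule.span R {x : A | ∃ r : ℤ, -h ≤ r ∧ r ≤ h' ∧ x = ((D.y ^ r : Aˣ) : A)}

variable (D : Gens A)

/-- The element `Yᵢ'` as a unit. -/
def YU : ℕ → Aˣ
  | 0 => D.y
  | 1 => D.y
  | i + 2 => D.X (i + 1) * YU (i + 1) * D.X (i + 1)

theorem YU_one : D.YU 1 = D.y := rfl

theorem YU_succ {i : ℕ} (hi : 1 ≤ i) : D.YU (i + 1) = D.X i * D.YU i * D.X i := by
  obtain ⟨i, rfl⟩ := Nat.exists_eq_add_of_le' hi
  rfl

/-- The subalgebra generated by `Y`, `X₁, …, X_{m-1}`, `e₁, …, e_{m-1}` for `m ≥ 1`, and the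
scalars for `m = 0`. -/
def C (R : Type*) [CommRing R] [Algebra R A] (m : ℕ) : Subalgebra R A :=
  Algebra.adjoin R {a | (1 ≤ m ∧ (a = D.y ∨ a = ↑D.y⁻¹)) ∨
    ∃ i, 1 ≤ i ∧ i + 1 ≤ m ∧ (a = D.X i ∨ a = ↑(D.X i)⁻¹ ∨ a = D.E i)}

variable {D} {N : ℕ} {δ : R} {lam : Rˣ} {h h' : ℤ}

theorem C_mono {m m' : ℕ} (hm : m ≤ m') : D.C R m ≤ D.C R m' := by
  refine Algebra.adjoin_mono ?_
  rintro a (⟨h1, h2⟩ | ⟨i, h1, h2, h3⟩)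
  · exact Or.inl ⟨by omega, h2⟩
  · exact Or.inr ⟨i, h1, by omega, h3⟩

theorem y_mem_C {m : ℕ} (hm : 1 ≤ m) : (D.y : A) ∈ D.C R m :=
  Algebra.subset_adjoin (Or.inl ⟨hm, Or.inl rfl⟩)

theorem yi_mem_C {m : ℕ} (hm : 1 ≤ m) : (↑D.y⁻¹ : A) ∈ D.C R m :=
  Algebra.subset_adjoin (Or.inl ⟨hm, Or.inr rfl⟩)

theorem X_mem_C {i m : ℕ} (hi : 1 ≤ i) (hm : i + 1 ≤ m) : (D.X i : A) ∈ D.C R m :=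
  Algebra.subset_adjoin (Or.inr ⟨i, hi, hm, Or.inl rfl⟩)

theorem Xi_mem_C {i m : ℕ} (hi : 1 ≤ i) (hm : i + 1 ≤ m) : (↑(D.X i)⁻¹ : A) ∈ D.C R m :=
  Algebra.subset_adjoin (Or.inr ⟨i, hi, hm, Or.inr (Or.inl rfl)⟩)

theorem E_mem_C {i m : ℕ} (hi : 1 ≤ i) (hm : i + 1 ≤ m) : D.E i ∈ D.C R m :=
  Algebra.subset_adjoin (Or.inr ⟨i, hi, hm, Or.inr (Or.inr rfl)⟩)

theorem YU_mem_C {i : ℕ} (hi : 1 ≤ i) : ∀ {m : ℕ}, i ≤ m →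
    (D.YU i : A) ∈ D.C R m ∧ (↑(D.YU i)⁻¹ : A) ∈ D.C R m := by
  induction i, hi using Nat.le_induction with
  | base => exact fun hm => ⟨y_mem_C hm, yi_mem_C hm⟩
  | succ i hi ih =>
    intro m hm
    have := @ih m (by omega)
    rw [D.YU_succ hi]
    simp only [mul_inv_rev, Units.val_mul]
    exact ⟨mul_mem (mul_mem (X_mem_C hi hm) this.1) (X_mem_C hi hm),
      mul_mem (Xi_mem_C hi hm) (mul_mem this.2 (Xi_mem_C hi hm))⟩

theorem zpow_mem_of_mem {S : Subalgebra R A} {u : Aˣ} (hu : (u : A) ∈ S)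
    (hu' : (↑u⁻¹ : A) ∈ S) (p : ℤ) : ((u ^ p : Aˣ) : A) ∈ S := by
  obtain ⟨p, rfl | rfl⟩ := p.eq_nat_or_neg
  · simpa using pow_mem hu p
  · simpa using pow_mem hu' p

theorem YU_zpow_mem_C {i m : ℕ} (hi : 1 ≤ i) (hm : i ≤ m) (p : ℤ) :
    ((D.YU i ^ p : Aˣ) : A) ∈ D.C R m :=
  zpow_mem_of_mem (YU_mem_C hi hm).1 (YU_mem_C hi hm).2 p

theorem commute_of_mem_C {m : ℕ} {b : A} (hy : 1 ≤ m → Commute b (D.y : A))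
    (hX : ∀ i, 1 ≤ i → i + 1 ≤ m → Commute b (D.X i : A))
    (hE : ∀ i, 1 ≤ i → i + 1 ≤ m → Commute b (D.E i)) : ∀ c ∈ D.C R m, Commute b c := by
  have : D.C R m ≤ Subalgebra.centralizer R {b} := by
    refine Algebra.adjoin_le ?_
    rintro a (⟨h1, rfl | rfl⟩ | ⟨i, h1, h2, rfl | rfl | rfl⟩)
    all_goals
      simp only [SetLike.mem_coe, Subalgebra.mem_centralizer_iff, Set.mem_singleton_iff,
        forall_eq]
    · exact hy h1
    · exact (hy h1).units_inv_right
    · exact hX i h1 h2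
    · exact (hX i h1 h2).units_inv_right
    · exact hE i h1 h2
  intro c hc
  have := this hc
  simp only [Subalgebra.mem_centralizer_iff, Set.mem_singleton_iff, forall_eq] at this
  exact this

namespace IsBMW

variable (H : D.IsBMW N δ lam h h')
include H

theorem X_comm_X {i j : ℕ} (hi : 1 ≤ i) (hj : 1 ≤ j) (hi' : i ≤ N) (hj' : j ≤ N)
    (hij : i + 2 ≤ j ∨ j + 2 ≤ i) : Commute (D.X i) (D.X j) := by
  rcases hij with hij | hij
  · exact H.XX_far i j hi hij hj'
  · exact (H.XX_far j i hj hij hi').symm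

theorem X_comm_E {i j : ℕ} (hi : 1 ≤ i) (hj : 1 ≤ j) (hi' : i ≤ N) (hj' : j ≤ N)
    (hij : i + 2 ≤ j ∨ j + 2 ≤ i) : Commute (D.X i : A) (D.E j) := by
  rcases hij with hij | hij
  · exact H.XE_far i j hi hij hj'
  · exact (H.EX_far j i hj hij hi').symm

theorem E_comm_E {i j : ℕ} (hi : 1 ≤ i) (hj : 1 ≤ j) (hi' : i ≤ N) (hj' : j ≤ N)
    (hij : i + 2 ≤ j ∨ j + 2 ≤ i) : Commute (D.E i) (D.E j) := by
  rcases hij with hij | hij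
  · exact H.EE_far i j hi hij hj'
  · exact (H.EE_far j i hj hij hi').symm

theorem X_comm_C {t m : ℕ} (ht : m + 1 ≤ t) (htN : t ≤ N) :
    ∀ c ∈ D.C R m, Commute (D.X t : A) c :=
  commute_of_mem_C (fun _ => (Commute.units_val (H.yX t (by omega) htN)).symm)
    (fun i h1 h2 => Commute.units_val (H.X_comm_X (by omega) h1 htN (by omega) (by omega)))
    (fun i h1 h2 => H.X_comm_E (by omega) h1 htN (by omega) (by omega))

theorem E_comm_C {t m : ℕ} (ht : m + 1 ≤ t) (htN : t ≤ N) :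
    ∀ c ∈ D.C R m, Commute (D.E t) c :=
  commute_of_mem_C (fun _ => (H.yE t (by omega) htN).symm)
    (fun i h1 h2 => (H.X_comm_E h1 (by omega) (by omega) htN (by omega)).symm)
    (fun i h1 h2 => H.E_comm_E (by omega) h1 htN (by omega) (by omega))

theorem X_comm_YU_of_lt {i t : ℕ} (hi : 1 ≤ i) (hit : i < t) (ht : t ≤ N) :
    Commute (D.X t) (D.YU i) :=
  Units.ext (H.X_comm_C hit ht _ (YU_mem_C hi le_rfl).1)

theorem E_comm_YU_of_lt {i t : ℕ} (hi : 1 ≤ i) (hit : i < t) (ht : t ≤ N) :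
    Commute (D.E t) (D.YU i : A) :=
  H.E_comm_C hit ht _ (YU_mem_C hi le_rfl).1

theorem X_comm_YU_add_two {t : ℕ} (ht : 1 ≤ t) (htN : t + 1 ≤ N) :
    Commute (D.X t) (D.YU (t + 2)) := by
  have h1 := H.braid t ht htN
  have h2 := (H.X_comm_YU_of_lt (t := t + 1) ht (by omega) htN).eq
  rw [D.YU_succ (by omega), D.YU_succ ht, commute_iff_eq]
  calc _ = (D.X t * D.X (t + 1) * D.X t) * D.YU t * D.X t * D.X (t + 1) := by group
    _ = D.X (t + 1) * D.X t * (D.X (t + 1) * D.YU t) * D.X t * D.X (t + 1) := by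
      rw [h1]; group
    _ = D.X (t + 1) * D.X t * D.YU t * (D.X (t + 1) * D.X t * D.X (t + 1)) := by
      rw [h2]; group
    _ = _ := by rw [← h1]; group

theorem E_mul_XX {t : ℕ} (ht : 1 ≤ t) (htN : t + 1 ≤ N) :
    D.E t * ((D.X (t + 1) : A) * D.X t) = D.X (t + 1) * D.X t * D.E (t + 1) := by
  rw [H.EXX_down t ht htN, mul_assoc, H.XXE_down t ht htN]

theorem E_succ_mul_XX {t : ℕ} (ht : 1 ≤ t) (htN : t + 1 ≤ N) :
    D.E (t + 1) * ((D.X t : A) * D.X (t + 1)) = D.X t * D.X (t + 1) * D.E t := by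
  rw [H.EXX_up t ht htN, mul_assoc, H.XXE_up t ht htN]

theorem E_comm_YU_add_two {t : ℕ} (ht : 1 ≤ t) (htN : t + 1 ≤ N) :
    Commute (D.E t) (D.YU (t + 2) : A) := by
  have h2 := (H.E_comm_YU_of_lt (t := t + 1) ht (by omega) htN).eq
  rw [D.YU_succ (by omega), D.YU_succ ht, commute_iff_eq]
  simp only [Units.val_mul]
  calc _ = D.E t * ((D.X (t + 1) : A) * D.X t) * D.YU t * D.X t * D.X (t + 1) := by
        simp only [mul_assoc]
    _ = D.X (t + 1) * D.X t * (D.E (t + 1) * D.YU t) * D.X t * D.X (t + 1) := by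
        rw [H.E_mul_XX ht htN]; simp only [mul_assoc]
    _ = D.X (t + 1) * D.X t * D.YU t * (D.E (t + 1) * (D.X t * D.X (t + 1))) := by
        rw [h2]; simp only [mul_assoc]
    _ = _ := by rw [H.E_succ_mul_XX ht htN]; simp only [mul_assoc]

theorem comm_YU_of_add_two_le {t i : ℕ} (ht : 1 ≤ t) (hi : t + 2 ≤ i) (hN : i ≤ N + 1) :
    Commute (D.X t) (D.YU i) ∧ Commute (D.E t) (D.YU i : A) := by
  induction i, hi using Nat.le_induction with
  | base => exact ⟨H.X_comm_YU_add_two ht (by omega), H.E_comm_YU_add_two ht (by omega)⟩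
  | succ i hi ih =>
    obtain ⟨h1, h2⟩ := ih (by omega)
    have h3 := H.XX_far t i ht hi (by omega)
    have h4 := H.EX_far t i ht hi (by omega)
    rw [D.YU_succ (by omega)]
    simp only [Units.val_mul]
    exact ⟨(h3.mul_right h1).mul_right h3, (h4.mul_right h2).mul_right h4⟩

theorem y_comm_YU {i : ℕ} (hi : 1 ≤ i) (hN : i ≤ N + 1) : Commute D.y (D.YU i) := by
  induction i, hi using Nat.le_induction with
  | base => exact Commute.refl _
  | succ i hi ih =>
    rw [D.YU_succ hi]
    rcases Nat.lt_or_ge 1 i with h1 | h1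
    · have h2 := H.yX i h1 (by omega)
      exact (h2.mul_right (ih (by omega))).mul_right h2
    · obtain rfl : i = 1 := by omega
      have := H.braidB (by omega)
      rw [YU_one, commute_iff_eq, this]
      group

theorem YU_succ_comm_C {i m : ℕ} (hm : m < i) (hN : i ≤ N + 1) :
    ∀ c ∈ D.C R m, Commute (D.YU i : A) c :=
  commute_of_mem_C (fun _ => (Commute.units_val (H.y_comm_YU (by omega) hN)).symm)
    (fun _ h1 _ => (Commute.units_val (H.comm_YU_of_add_two_le h1 (by omega) hN).1).symm)
    (fun _ h1 _ => (H.comm_YU_of_add_two_le h1 (by omega) hN).2.symm)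

theorem YU_comm_YU {i j : ℕ} (hi : 1 ≤ i) (hj : 1 ≤ j) (hi' : i ≤ N + 1) (hj' : j ≤ N + 1) :
    Commute (D.YU i) (D.YU j) := by
  rcases lt_trichotomy i j with hij | rfl | hij
  · exact (Units.ext (H.YU_succ_comm_C hij hj' _ (YU_mem_C hi le_rfl).1) : Commute _ _).symm
  · exact Commute.refl _
  · exact Units.ext (H.YU_succ_comm_C hij hi' _ (YU_mem_C hj le_rfl).1)

theorem E_comm_YU {t i : ℕ} (ht : 1 ≤ t) (htN : t ≤ N) (hi : 1 ≤ i) (hN : i ≤ N + 1)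
    (hit : i < t ∨ t + 2 ≤ i) : Commute (D.E t) (D.YU i : A) := by
  rcases hit with hit | hit
  · exact H.E_comm_YU_of_lt hi hit htN
  · exact (H.comm_YU_of_add_two_le ht hit hN).2

theorem YU_mul_E {i : ℕ} (hi : 1 ≤ i) (hN : i ≤ N) :
    (D.YU i : A) * (D.YU (i + 1) * D.E i) = D.E i ∧
      D.E i * ((D.YU (i + 1) : A) * D.YU i) = D.E i := by
  induction i, hi using Nat.le_induction with
  | base =>
    have hc := (H.y_comm_YU (i := 2) (by omega) (by omega)).eq
    rw [D.YU_succ le_rfl, YU_one] at hc ⊢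
    have hc' := congrArg (Units.val) hc
    simp only [Units.val_mul] at hc' ⊢
    constructor
    · rw [← mul_assoc, hc']
      simp only [mul_assoc]
      rw [H.yXyE (by omega), mul_smul_comm, H.XE 1 le_rfl hN, smul_smul, Units.inv_mul, one_smul]
    · simp only [mul_assoc]
      rw [← mul_assoc (D.E 1), H.EX 1 le_rfl hN, smul_mul_assoc, H.EyXy (by omega), smul_smul,
        Units.mul_inv, one_smul]
  | succ i hi ih =>
    obtain ⟨h1, h2⟩ := ih (by omega)
    have hb := H.braid i hi hN
    have hby := (H.X_comm_YU_of_lt (t := i + 1) hi (by omega) hN).eq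
    have hyz := (H.YU_comm_YU (i := i) (j := i + 1) hi (by omega) (by omega) (by omega)).eq
    have hz := D.YU_succ hi
    set a := D.X i
    set b := D.X (i + 1)
    set y := D.YU i
    set z := D.YU (i + 1)
    have hz' : D.YU (i + 1 + 1) = b * z * b := D.YU_succ (by omega)
    have e1 : b * a⁻¹ * b⁻¹ = a⁻¹ * b⁻¹ * a := by
      rw [mul_inv_eq_iff_eq_mul, mul_assoc _ a b, mul_assoc a⁻¹, eq_inv_mul_iff_mul_eq,
        eq_inv_mul_iff_mul_eq, ← mul_assoc, ← mul_assoc, ← hb]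
      group
    have e2 : b⁻¹ * a⁻¹ * b = a * b⁻¹ * a⁻¹ := by
      rw [eq_mul_inv_iff_mul_eq, eq_mul_inv_iff_mul_eq, mul_assoc, mul_assoc, ← mul_assoc b,
        ← hb]
      group
    have u1 : z * (b * z * b) * (a⁻¹ * b⁻¹) = a * b * (y * z) := by
      calc _ = z * b * z * (b * a⁻¹ * b⁻¹) := by group
        _ = z * b * (z * a⁻¹) * b⁻¹ * a := by rw [e1]; group
        _ = z * b * a * (y * b⁻¹) * a := by rw [hz]; group
        _ = z * (b * a * b⁻¹) * y * a := by
          rw [show y * b⁻¹ = b⁻¹ * y from by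
            rw [mul_inv_eq_iff_eq_mul, mul_assoc, ← hby]; group]
          group
        _ = z * (a⁻¹ * b * a) * y * a := by
          congr 3
          rw [mul_inv_eq_iff_eq_mul, mul_assoc, mul_assoc, eq_inv_mul_iff_mul_eq]
          simp only [← mul_assoc, hb]
        _ = a * (y * b) * z := by rw [hz]; group
        _ = _ := by rw [← hby]; group
    have u2 : b⁻¹ * a⁻¹ * ((b * z * b) * z) = z * y * b * a := by
      calc _ = (b⁻¹ * a⁻¹ * b) * z * b * z := by group
        _ = a * b⁻¹ * (a⁻¹ * z) * b * z := by rw [e2]; group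
        _ = a * (b⁻¹ * y) * a * b * z := by rw [hz]; group
        _ = a * y * (b⁻¹ * a * b) * z := by
          rw [show b⁻¹ * y = y * b⁻¹ from by
            rw [inv_mul_eq_iff_eq_mul, ← mul_assoc, hby]; group]
          group
        _ = a * y * (a * b * a⁻¹) * z := by
          congr 2
          rw [eq_mul_inv_iff_mul_eq, mul_assoc, mul_assoc, inv_mul_eq_iff_eq_mul]
          simp only [← mul_assoc, hb]
        _ = z * (b * y) * a := by rw [hz]; group
        _ = _ := by rw [hby]; group
    have w1 : D.E (i + 1) = (↑(a⁻¹ * b⁻¹) : A) * (D.E i * D.E (i + 1)) := by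
      rw [← H.XXE_down i hi hN]
      simp [a, b, mul_assoc]
    have w2 : D.E (i + 1) = D.E (i + 1) * D.E i * (↑(b⁻¹ * a⁻¹) : A) := by
      rw [← H.EXX_up i hi hN]
      simp [a, b, mul_assoc]
    rw [hz']
    constructor
    · rw [← mul_assoc, ← Units.val_mul]
      nth_rewrite 1 [w1]
      rw [← mul_assoc, ← Units.val_mul, u1]
      simp only [Units.val_mul, mul_assoc]
      rw [← mul_assoc (z : A), mul_mul_of_eq h1, ← mul_assoc (b : A), mul_mul_of_eq (H.XXE_up i hi hN), mul_assoc, H.EEE_down i hi hN]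
    · nth_rewrite 1 [w2]
      rw [← Units.val_mul, mul_assoc (D.E (i + 1) * D.E i), ← Units.val_mul, u2]
      simp only [Units.val_mul, mul_assoc]
      rw [← mul_assoc (z : A), mul_mul_of_eq h2, H.EXX_down i hi hN,
        H.EEE_down i hi hN]

theorem localRel {i : ℕ} (hi : 1 ≤ i) (hN : i ≤ N) :
    LocalRel δ lam (D.X i) (D.YU i) (D.YU (i + 1)) (D.E i) := by
  have hc := H.YU_comm_YU (i := i) (j := i + 1) hi (by omega) (by omega) (by omega)
  obtain ⟨h1, h2⟩ := H.YU_mul_E hi hN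
  exact
  { skein := H.skein i hi hN
    conj := (D.YU_succ hi).symm
    comm := hc
    yze := by rw [mul_assoc, h1]
    eyz := by rw [mul_assoc, ← Units.val_mul, hc.eq, Units.val_mul, h2]
    xe := H.XE i hi hN
    ex := H.EX i hi hN }

theorem Xi_E_succ {i : ℕ} (hi : 1 ≤ i) (hN : i + 1 ≤ N) :
    (↑(D.X i)⁻¹ : A) * D.E (i + 1) = D.X (i + 1) * (D.E i * D.E (i + 1)) := by
  rw [Units.inv_mul_eq_iff_eq_mul, ← mul_assoc (D.X (i + 1) : A),
    mul_mul_of_eq (H.XXE_up i hi hN), mul_assoc, H.EEE_down i hi hN]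

theorem X_E_succ {i : ℕ} (hi : 1 ≤ i) (hN : i + 1 ≤ N) :
    (D.X i : A) * D.E (i + 1) = ↑(D.X (i + 1))⁻¹ * (D.E i * D.E (i + 1)) := by
  rw [Units.eq_inv_mul_iff_mul_eq, H.XXE_down i hi hN]

theorem E_succ_X {i : ℕ} (hi : 1 ≤ i) (hN : i + 1 ≤ N) :
    D.E (i + 1) * (D.X i : A) = D.E (i + 1) * (D.E i * ↑(D.X (i + 1))⁻¹) := by
  rw [← mul_assoc, Units.eq_mul_inv_iff_mul_eq, mul_assoc, H.EXX_up i hi hN]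

theorem E_succ_Xi {i : ℕ} (hi : 1 ≤ i) (hN : i + 1 ≤ N) :
    D.E (i + 1) * (↑(D.X i)⁻¹ : A) = D.E (i + 1) * (D.E i * D.X (i + 1)) := by
  rw [Units.mul_inv_eq_iff_eq_mul]
  simp only [mul_assoc]
  rw [H.EXX_down i hi hN, H.EEE_down i hi hN]

/-- `eᵢ (Yᵢ')^p eᵢ ∈ eᵢ C_{i-1}`. -/
theorem E_YU_zpow_E {i : ℕ} (hi : 1 ≤ i) (hN : i ≤ N) :
    ∀ p : ℤ, ∃ d ∈ D.C R (i - 1), D.E i * (((D.YU i ^ p : Aˣ) : A) * D.E i) = D.E i * d := by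
  induction i, hi using Nat.le_induction with
  | base =>
    intro p
    obtain ⟨a, ha⟩ := H.EyE hN p
    exact ⟨algebraMap R A a, Subalgebra.algebraMap_mem _ a, by
      rw [YU_one, ha, Algebra.smul_def, Algebra.commutes]⟩
  | succ i hi ih =>
    have hl := H.localRel (i := i) hi (by omega)
    have hs := H.localRel (i := i + 1) (by omega) hN
    have hcomm : ∀ p : ℤ, Commute ((D.YU i ^ p : Aˣ) : A) (D.X (i + 1) : A) := fun p =>
      coe_zpow_comm (Commute.units_val (H.X_comm_YU_of_lt hi (by omega) hN)).symm p
    have hcomm' : ∀ p : ℤ, ∀ t, ((D.YU i ^ p : Aˣ) : A) * ((D.X (i + 1) : A) * t) =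
        (D.X (i + 1) : A) * (((D.YU i ^ p : Aˣ) : A) * t) := fun p t => by
      rw [← mul_assoc, (hcomm p).eq, mul_assoc]
    have hcomm'' : ∀ p : ℤ, ∀ t, ((D.YU i ^ p : Aˣ) : A) * ((↑(D.X (i + 1))⁻¹ : A) * t) =
        (↑(D.X (i + 1))⁻¹ : A) * (((D.YU i ^ p : Aˣ) : A) * t) := fun p t => by
      rw [← mul_assoc, (hcomm p).units_inv_right.eq, mul_assoc]
    refine hl.f_zpow_f_mem (D := D.C R i) (fun p => YU_zpow_mem_C hi le_rfl p)
      (H.E_comm_C (by omega) hN) (H.EEE_down i hi hN) ?_ ?_ ?_ ?_ ?_ ?_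
    · obtain ⟨a, ha⟩ := H.EE
      exact ⟨algebraMap R A a, Subalgebra.algebraMap_mem _ a, by
        rw [ha _ (by omega) hN, Algebra.smul_def, Algebra.commutes]⟩
    · rw [H.Xi_E_succ hi hN, ← mul_assoc, H.EX _ (by omega) hN, smul_mul_assoc,
        H.EEE_down i hi hN]
    · rw [H.X_E_succ hi hN, ← mul_assoc, hs.e_xi, smul_mul_assoc, H.EEE_down i hi hN]
    · intro p
      obtain ⟨d, hd, h1⟩ := ih (by omega) p
      exact ⟨d, C_mono (by omega) hd, h1⟩
    · intro p
      rw [H.Xi_E_succ hi hN, ← mul_assoc, H.E_succ_X hi hN, hcomm']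
      simp only [mul_assoc, Units.inv_mul_cancel_left]
    · intro p
      rw [H.X_E_succ hi hN, ← mul_assoc, H.E_succ_Xi hi hN, hcomm'']
      simp only [mul_assoc, Units.mul_inv_cancel_left]

end IsBMW

section Words

variable (D : Gens A)

/-- `Xᵢ ⋯ X_{j-1}`. -/
def Xs (i j : ℕ) : Aˣ := ((List.range' i (j - i)).map D.X).prod

/-- `e_j ⋯ e_l`. -/
def Es (j l : ℕ) : A := ((List.range' j (l + 1 - j)).map D.E).prod

/-- `Xᵢ ⋯ X_{j-1} e_j ⋯ e_l`. -/
def bet (i j l : ℕ) : A := D.Xs i j * D.Es j l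

/-- `(Yᵢ')^r Xᵢ ⋯ X_{j-1} e_j ⋯ e_l`. -/
def al (i j l : ℕ) (r : ℤ) : A := ((D.YU i ^ r : Aˣ) : A) * D.bet i j l

theorem Xs_self (i : ℕ) : D.Xs i i = 1 := by simp [Xs]

theorem Xs_mul_Xs {i j k : ℕ} (hij : i ≤ j) (hjk : j ≤ k) : D.Xs i j * D.Xs j k = D.Xs i k := by
  have := List.range'_append (s := i) (m := j - i) (n := k - j) (step := 1)
  rw [one_mul, Nat.add_sub_cancel' hij, show j - i + (k - j) = k - i by omega] at this
  rw [Xs, Xs, Xs, ← this, List.map_append, List.prod_append]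

theorem Xs_succ_self (i : ℕ) : D.Xs i (i + 1) = D.X i := by simp [Xs]

theorem Xs_succ {i j : ℕ} (hij : i ≤ j) : D.Xs i (j + 1) = D.Xs i j * D.X j := by
  rw [← D.Xs_mul_Xs hij (Nat.le_succ j), Xs_succ_self]

theorem Xs_head {i j : ℕ} (hij : i < j) : D.Xs i j = D.X i * D.Xs (i + 1) j := by
  rw [← D.Xs_mul_Xs (Nat.le_succ i) hij, Xs_succ_self]

theorem Es_eq_one (l : ℕ) : D.Es (l + 1) l = 1 := by simp [Es]

theorem Es_mul_Es {j k l : ℕ} (hjk : j ≤ k + 1) (hkl : k ≤ l) :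
    D.Es j k * D.Es (k + 1) l = D.Es j l := by
  have := List.range'_append (s := j) (m := k + 1 - j) (n := l + 1 - (k + 1)) (step := 1)
  rw [one_mul, Nat.add_sub_cancel' hjk,
    show k + 1 - j + (l + 1 - (k + 1)) = l + 1 - j by omega] at this
  rw [Es, Es, Es, ← this, List.map_append, List.prod_append]

theorem Es_self (l : ℕ) : D.Es l l = D.E l := by simp [Es]

theorem Es_head {j l : ℕ} (hjl : j ≤ l) : D.Es j l = D.E j * D.Es (j + 1) l := by
  rw [← D.Es_mul_Es (Nat.le_succ j) hjl, Es_self]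

theorem Es_succ {j l : ℕ} (hjl : j ≤ l + 1) : D.Es j (l + 1) = D.Es j l * D.E (l + 1) := by
  rw [← D.Es_mul_Es hjl (Nat.le_succ l), Es_self]

theorem bet_self (i l : ℕ) : D.bet i i l = D.Es i l := by simp [bet, Xs_self]

theorem bet_head {i j l : ℕ} (hij : i < j) : D.bet i j l = D.X i * D.bet (i + 1) j l := by
  rw [bet, bet, D.Xs_head hij, Units.val_mul, mul_assoc]

theorem al_zero (i j l : ℕ) : D.al i j l 0 = D.bet i j l := by simp [al]

variable {D}

theorem commute_Xs {a : Aˣ} {i j : ℕ} (ha : ∀ t, i ≤ t → t < j → Commute a (D.X t)) :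
    Commute a (D.Xs i j) := by
  refine Commute.list_prod_right _ _ ?_
  intro b hb
  obtain ⟨t, ht, rfl⟩ := List.mem_map.1 hb
  obtain ⟨h1, h2⟩ := List.mem_range'_1.1 ht
  exact ha t h1 (by omega)

theorem commute_val_Xs {a : A} {i j : ℕ} (ha : ∀ t, i ≤ t → t < j → Commute a (D.X t : A)) :
    Commute a (D.Xs i j : A) := by
  rw [Xs, ← Units.coeHom_apply, map_list_prod]
  refine Commute.list_prod_right _ _ ?_
  intro b hb
  obtain ⟨u, hu, rfl⟩ := List.mem_map.1 hb
  obtain ⟨t, ht, rfl⟩ := List.mem_map.1 hu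
  obtain ⟨h1, h2⟩ := List.mem_range'_1.1 ht
  exact ha t h1 (by omega)

theorem commute_Es {a : A} {j l : ℕ} (ha : ∀ t, j ≤ t → t ≤ l → Commute a (D.E t)) :
    Commute a (D.Es j l) := by
  refine Commute.list_prod_right _ _ ?_
  intro b hb
  obtain ⟨t, ht, rfl⟩ := List.mem_map.1 hb
  obtain ⟨h1, h2⟩ := List.mem_range'_1.1 ht
  exact ha t h1 (by omega)

theorem Xs_mem_C {i j m : ℕ} (hi : 1 ≤ i) (hj : j ≤ m) : (D.Xs i j : A) ∈ D.C R m := by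
  rw [Xs, ← Units.coeHom_apply, map_list_prod]
  refine Subalgebra.list_prod_mem _ ?_
  intro b hb
  obtain ⟨u, hu, rfl⟩ := List.mem_map.1 hb
  obtain ⟨t, ht, rfl⟩ := List.mem_map.1 hu
  obtain ⟨h1, h2⟩ := List.mem_range'_1.1 ht
  exact X_mem_C (by omega) (by omega)

theorem Es_mem_C {j l m : ℕ} (hj : 1 ≤ j) (hl : l < m) : D.Es j l ∈ D.C R m := by
  refine Subalgebra.list_prod_mem _ ?_
  intro b hb
  obtain ⟨t, ht, rfl⟩ := List.mem_map.1 hb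
  obtain ⟨h1, h2⟩ := List.mem_range'_1.1 ht
  exact E_mem_C (by omega) (by omega)

theorem bet_mem_C {i j l m : ℕ} (hi : 1 ≤ i) (hij : i ≤ j) (hj : j ≤ l + 1) (hl : l < m) :
    D.bet i j l ∈ D.C R m :=
  mul_mem (Xs_mem_C hi (by omega)) (Es_mem_C (by omega) hl)

theorem al_mem_C {i j l m : ℕ} (hi : 1 ≤ i) (hij : i ≤ j) (hj : j ≤ l + 1) (hl : l < m) (r : ℤ) :
    D.al i j l r ∈ D.C R m :=
  mul_mem (YU_zpow_mem_C hi (by omega) r) (bet_mem_C hi hij hj hl)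

end Words

namespace IsBMW

variable (H : D.IsBMW N δ lam h h')
include H

theorem Xs_comm_C {i j m : ℕ} (hi : m + 1 ≤ i) (hj : j ≤ N + 1) :
    ∀ c ∈ D.C R m, Commute (D.Xs i j : A) c := fun c hc =>
  (commute_val_Xs fun t h1 h2 => (H.X_comm_C (by omega) (by omega) c hc).symm).symm

theorem Es_comm_C {j l m : ℕ} (hj : m + 1 ≤ j) (hl : l ≤ N) :
    ∀ c ∈ D.C R m, Commute (D.Es j l) c := fun c hc =>
  (commute_Es fun t h1 h2 => (H.E_comm_C (by omega) (by omega) c hc).symm).symm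

theorem bet_comm_C {i j l m : ℕ} (hi : m + 1 ≤ i) (hij : i ≤ j) (hj : j ≤ N + 1) (hl : l ≤ N) :
    ∀ c ∈ D.C R m, Commute (D.bet i j l) c := fun c hc =>
  (H.Xs_comm_C hi hj c hc).mul_left (H.Es_comm_C (by omega) hl c hc)

theorem X_mul_Xs {i j t : ℕ} (hi : 1 ≤ i) (hit : i ≤ t) (htj : t + 1 < j) (hj : j ≤ N + 1) :
    (D.X (t + 1) : A) * D.Xs i j = D.Xs i j * D.X t := by
  have h1 : Commute (D.X (t + 1)) (D.Xs i t) := commute_Xs fun s hs hs' =>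
    H.X_comm_X (by omega) (by omega) (by omega) (by omega) (by omega)
  have h2 : Commute (D.X t) (D.Xs (t + 2) j) := commute_Xs fun s hs hs' =>
    H.X_comm_X (by omega) (by omega) (by omega) (by omega) (by omega)
  have h3 := H.braid t (by omega) (by omega)
  rw [← Units.val_mul, ← Units.val_mul, ← D.Xs_mul_Xs (j := t + 2) (by omega) (by omega),
    D.Xs_succ (by omega), D.Xs_succ hit]
  simp only [mul_assoc]
  rw [h1.left_comm, ← h2.eq]
  simp only [← mul_assoc] at h3 ⊢
  rw [mul_assoc (D.Xs i t), mul_assoc (D.Xs i t), ← h3]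
  simp only [mul_assoc]

theorem E_mul_Xs {i j t : ℕ} (hi : 1 ≤ i) (hit : i ≤ t) (htj : t + 1 < j) (hj : j ≤ N + 1) :
    D.E (t + 1) * (D.Xs i j : A) = D.Xs i j * D.E t := by
  have h1 : Commute (D.E (t + 1)) (D.Xs i t : A) := commute_val_Xs fun s hs hs' =>
    (H.X_comm_E (by omega) (by omega) (by omega) (by omega) (by omega)).symm
  have h2 : Commute (D.E t) (D.Xs (t + 2) j : A) := commute_val_Xs fun s hs hs' =>
    (H.X_comm_E (by omega) (by omega) (by omega) (by omega) (by omega)).symm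
  have h3 := H.E_succ_mul_XX (t := t) (by omega) (by omega)
  rw [← D.Xs_mul_Xs (j := t + 2) (by omega) (by omega),
    D.Xs_succ (by omega), D.Xs_succ hit]
  simp only [Units.val_mul]
  rw [mul_assoc _ _ (D.E t), ← h2.eq, mul_assoc (D.Xs i t : A), ← mul_assoc, ← mul_assoc, h1.eq,
    mul_assoc (D.Xs i t : A), h3]
  simp only [mul_assoc]

theorem X_mul_EEE {t : ℕ} (ht : 1 ≤ t) (hN : t + 2 ≤ N) :
    (D.X (t + 2) : A) * (D.E t * (D.E (t + 1) * D.E (t + 2))) =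
      D.E t * (D.E (t + 1) * (D.E (t + 2) * D.X t)) := by
  have h1 := (H.EX_far t (t + 2) ht le_rfl hN).eq
  have h2 := (H.XE_far t (t + 2) ht le_rfl hN).eq
  have h3 : D.E t * (D.E (t + 1) * (D.X t : A)) = D.E t * ↑(D.X (t + 1))⁻¹ := by
    rw [Units.eq_mul_inv_iff_mul_eq]
    simp only [mul_assoc]
    rw [H.EXX_up t ht (by omega), H.EEE_up t ht (by omega)]
  rw [← mul_assoc, ← h1, mul_assoc, ← H.Xi_E_succ (i := t + 1) (by omega) hN, ← h2,
    ← mul_assoc (D.E (t + 1)), ← mul_assoc (D.E t) (D.E (t + 1) * _), h3, mul_assoc]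

theorem E_mul_EEE {t : ℕ} (ht : 1 ≤ t) (hN : t + 2 ≤ N) :
    D.E (t + 2) * (D.E t * (D.E (t + 1) * D.E (t + 2))) =
      D.E t * (D.E (t + 1) * (D.E (t + 2) * D.E t)) := by
  have h1 := (H.EE_far t (t + 2) ht le_rfl hN).eq
  rw [← mul_assoc, ← h1, mul_assoc, H.EEE_down (t + 1) (by omega) hN, ← mul_assoc (D.E (t + 1)),
    ← mul_assoc (D.E t), H.EEE_up t ht (by omega)]

theorem X_mul_Es {j l t : ℕ} (hj : 1 ≤ j) (hjt : j ≤ t) (htl : t + 2 ≤ l) (hl : l ≤ N) :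
    (D.X (t + 2) : A) * D.Es j l = D.Es j l * D.X t := by
  obtain ⟨s, rfl⟩ := Nat.exists_eq_add_of_le' (hj.trans hjt)
  have h1 : Commute (D.X (s + 1 + 2) : A) (D.Es j s) := commute_Es fun u hu hu' =>
    H.X_comm_E (by omega) (by omega) (by omega) (by omega) (by omega)
  have h2 : Commute (D.X (s + 1) : A) (D.Es (s + 1 + 2 + 1) l) := commute_Es fun u hu hu' =>
    H.X_comm_E (by omega) (by omega) (by omega) (by omega) (by omega)
  have h3 := H.X_mul_EEE (t := s + 1) (by omega) (by omega)
  rw [← D.Es_mul_Es (k := s) (by omega) (by omega), D.Es_head (j := s + 1) (by omega),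
    D.Es_head (j := s + 1 + 1) (by omega), D.Es_head (j := s + 1 + 1 + 1) (by omega),
    ← mul_assoc, h1.eq]
  simp only [mul_assoc]
  rw [← h2.eq]
  congr 1
  simp only [← mul_assoc] at h3 ⊢
  rw [h3]

theorem E_mul_Es {j l t : ℕ} (hj : 1 ≤ j) (hjt : j ≤ t) (htl : t + 2 ≤ l) (hl : l ≤ N) :
    D.E (t + 2) * D.Es j l = D.Es j l * D.E t := by
  obtain ⟨s, rfl⟩ := Nat.exists_eq_add_of_le' (hj.trans hjt)
  have h1 : Commute (D.E (s + 1 + 2)) (D.Es j s) := commute_Es fun u hu hu' =>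
    H.E_comm_E (by omega) (by omega) (by omega) (by omega) (by omega)
  have h2 : Commute (D.E (s + 1)) (D.Es (s + 1 + 2 + 1) l) := commute_Es fun u hu hu' =>
    H.E_comm_E (by omega) (by omega) (by omega) (by omega) (by omega)
  have h3 := H.E_mul_EEE (t := s + 1) (by omega) (by omega)
  rw [← D.Es_mul_Es (k := s) (by omega) (by omega), D.Es_head (j := s + 1) (by omega),
    D.Es_head (j := s + 1 + 1) (by omega), D.Es_head (j := s + 1 + 1 + 1) (by omega),
    ← mul_assoc, h1.eq]
  simp only [mul_assoc]
  rw [← h2.eq]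
  congr 1
  simp only [← mul_assoc] at h3 ⊢
  rw [h3]

theorem X_mul_bet_of_lt {i j l t : ℕ} (hi : 1 ≤ i) (hit : i ≤ t) (htj : t + 1 < j) (hj : j ≤ l)
    (hl : l ≤ N) : (D.X (t + 1) : A) * D.bet i j l = D.bet i j l * D.X t := by
  rw [bet, ← mul_assoc, H.X_mul_Xs hi hit htj (by omega), mul_assoc, mul_assoc]
  congr 1
  exact (H.Es_comm_C (m := t + 1) (by omega) hl _ (X_mem_C (by omega) le_rfl)).eq.symm

theorem E_mul_bet_of_lt {i j l t : ℕ} (hi : 1 ≤ i) (hit : i ≤ t) (htj : t + 1 < j) (hj : j ≤ l)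
    (hl : l ≤ N) : D.E (t + 1) * D.bet i j l = D.bet i j l * D.E t := by
  rw [bet, ← mul_assoc, H.E_mul_Xs hi hit htj (by omega), mul_assoc, mul_assoc]
  congr 1
  exact (H.Es_comm_C (m := t + 1) (by omega) hl _ (E_mem_C (by omega) le_rfl)).eq.symm

theorem X_mul_bet_of_gt {i j l t : ℕ} (hi : 1 ≤ i) (hij : i ≤ j) (hjt : j ≤ t) (htl : t + 2 ≤ l)
    (hl : l ≤ N) : (D.X (t + 2) : A) * D.bet i j l = D.bet i j l * D.X t := by
  have h1 : Commute (D.X (t + 2) : A) (D.Xs i j : A) := commute_val_Xs fun u hu hu' =>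
    Commute.units_val (H.X_comm_X (by omega) (by omega) (by omega) (by omega) (by omega))
  rw [bet, ← mul_assoc, h1.eq, mul_assoc, mul_assoc, H.X_mul_Es (by omega) hjt htl hl]

theorem E_mul_bet_of_gt {i j l t : ℕ} (hi : 1 ≤ i) (hij : i ≤ j) (hjt : j ≤ t) (htl : t + 2 ≤ l)
    (hl : l ≤ N) : D.E (t + 2) * D.bet i j l = D.bet i j l * D.E t := by
  have h1 : Commute (D.E (t + 2)) (D.Xs i j : A) := commute_val_Xs fun u hu hu' =>
    (H.X_comm_E (by omega) (by omega) (by omega) (by omega) (by omega)).symm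
  rw [bet, ← mul_assoc, h1.eq, mul_assoc, mul_assoc, H.E_mul_Es (by omega) hjt htl hl]

theorem X_mul_bet_succ {i j l : ℕ} (hi : 1 ≤ i) (hij : i ≤ j) (hjl : j + 1 ≤ l) (hl : l ≤ N) :
    (D.X (j + 1) : A) * D.bet i (j + 1) l = D.bet i j l := by
  have h1 : Commute (D.X (j + 1) : A) (D.Xs i j : A) := commute_val_Xs fun u hu hu' =>
    Commute.units_val (H.X_comm_X (by omega) (by omega) (by omega) (by omega) (by omega))
  rw [bet, bet, D.Xs_succ hij, D.Es_head (j := j) (by omega), D.Es_head (j := j + 1) hjl,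
    Units.val_mul, ← mul_assoc (D.E j), ← H.XXE_down j (by omega) (by omega)]
  simp only [mul_assoc]
  rw [h1.left_comm]

theorem Xi_mul_bet {i j l : ℕ} (hi : 1 ≤ i) (hij : i ≤ j) (hjl : j + 1 ≤ l) (hl : l ≤ N) :
    (↑(D.X (j + 1))⁻¹ : A) * D.bet i j l = D.bet i (j + 1) l := by
  rw [← H.X_mul_bet_succ hi hij hjl hl, Units.inv_mul_cancel_left]

theorem E_succ_mul_bet {i j l : ℕ} (hi : 1 ≤ i) (hij : i ≤ j) (hjl : j + 1 ≤ l) (hl : l ≤ N) :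
    D.E (j + 1) * D.bet i j l = D.Es (j + 1) l * D.Xs i j := by
  have h1 : Commute (D.E (j + 1)) (D.Xs i j : A) := commute_val_Xs fun u hu hu' =>
    (H.X_comm_E (by omega) (by omega) (by omega) (by omega) (by omega)).symm
  have h2 : Commute (D.Es (j + 1) l) (D.Xs i j : A) := H.Es_comm_C le_rfl hl _
    (Xs_mem_C hi le_rfl)
  rw [h2.eq, bet, ← mul_assoc, h1.eq, mul_assoc, D.Es_head (j := j) (by omega),
    D.Es_head (j := j + 1) hjl, ← mul_assoc (D.E j), mul_mul_of_eq (H.EEE_down j (by omega)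
      (by omega))]

theorem E_succ_mul_bet_succ {i j l : ℕ} (hi : 1 ≤ i) (hij : i ≤ j) (hjl : j + 1 ≤ l)
    (hl : l ≤ N) :
    D.E (j + 1) * D.bet i (j + 1) l = ((lam⁻¹ : Rˣ) : R) • (D.Es (j + 1) l * D.Xs i j) := by
  rw [← H.Xi_mul_bet hi hij hjl hl, ← mul_assoc, (H.localRel (by omega) (by omega)).e_xi,
    smul_mul_assoc, H.E_succ_mul_bet hi hij hjl hl]

theorem Xi_mul_Es {j l t : ℕ} (hj : 1 ≤ j) (hjt : j ≤ t) (htl : t + 2 ≤ l) (hl : l ≤ N) :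
    (↑(D.X (t + 2))⁻¹ : A) * D.Es j l = D.Es j l * ↑(D.X t)⁻¹ := by
  rw [Units.inv_mul_eq_iff_eq_mul, ← mul_assoc, H.X_mul_Es hj hjt htl hl,
    Units.mul_inv_cancel_right]

/-- `eᵢ · Xᵢ₊₁ ⋯ X_{j-1} e_j ⋯ e_l ∈ eᵢ ⋯ e_l C_{l-1}`. -/
theorem E_mul_bet {i j l : ℕ} (hi : 1 ≤ i) (hij : i + 1 ≤ j) (hjl : j ≤ l) (hl : l ≤ N) :
    ∃ c ∈ D.C R (l - 1), D.E i * D.bet (i + 1) j l = D.Es i l * c := by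
  induction j, hij using Nat.le_induction with
  | base => exact ⟨1, one_mem _, by
      rw [bet_self, mul_one, D.Es_head (j := i) (by omega)]⟩
  | succ j hij ih =>
    obtain ⟨c, hc, h1⟩ := ih (by omega)
    obtain ⟨s, rfl⟩ := Nat.exists_eq_add_of_le' (show 1 ≤ j by omega)
    refine ⟨↑(D.X s)⁻¹ * c, mul_mem (Xi_mem_C (by omega) (by omega)) hc, ?_⟩
    have h2 := (H.EX_far i (s + 1 + 1) hi (by omega) (by omega)).units_inv_right
    rw [← H.Xi_mul_bet (by omega) hij hjl hl, ← mul_assoc, h2.eq, mul_assoc, h1, ← mul_assoc,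
      H.Xi_mul_Es hi (by omega) hjl hl, mul_assoc]

end IsBMW

variable (D) in
/-- The right `C_{l-1}`-module spanned by the `al i j l r` with admissible `(i, r)`. -/
def Sp (R : Type*) [CommRing R] [Algebra R A] (l : ℕ) (Adm : ℕ → ℤ → Prop) : Submodule R A :=
  Submodule.span R {a | ∃ i j r, ∃ c ∈ D.C R (l - 1), 1 ≤ i ∧ i ≤ j ∧ j ≤ l ∧ Adm i r ∧
    a = D.al i j l r * c}

theorem Sp_mul_mem {l : ℕ} {Adm : ℕ → ℤ → Prop} {a c : A} (ha : a ∈ D.Sp R l Adm)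
    (hc : c ∈ D.C R (l - 1)) : a * c ∈ D.Sp R l Adm := by
  induction ha using Submodule.span_induction with
  | mem x hx =>
    obtain ⟨i, j, r, d, hd, h1, h2, h3, h4, rfl⟩ := hx
    exact Submodule.subset_span
      ⟨i, j, r, d * c, mul_mem hd hc, h1, h2, h3, h4, mul_assoc _ _ _⟩
  | zero => rw [zero_mul]; exact zero_mem _
  | add x y _ _ hx hy => rw [add_mul]; exact add_mem hx hy
  | smul a x _ hx => rw [smul_mul_assoc]; exact Submodule.smul_mem _ _ hx

theorem al_mem_Sp {l : ℕ} {Adm : ℕ → ℤ → Prop} {i j : ℕ} {r : ℤ} (hi : 1 ≤ i) (hij : i ≤ j)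
    (hj : j ≤ l) (hr : Adm i r) : D.al i j l r ∈ D.Sp R l Adm :=
  Submodule.subset_span ⟨i, j, r, 1, one_mem _, hi, hij, hj, hr, (mul_one _).symm⟩

theorem Sp_mono {l : ℕ} {Adm Adm' : ℕ → ℤ → Prop} (hA : ∀ i r, Adm i r → Adm' i r) :
    D.Sp R l Adm ≤ D.Sp R l Adm' := by
  refine Submodule.span_mono ?_
  rintro _ ⟨i, j, r, d, hd, h1, h2, h3, h4, rfl⟩
  exact ⟨i, j, r, d, hd, h1, h2, h3, hA i r h4, rfl⟩

/-- `Xₜ` and `eₜ` map `a` into `S`. -/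
def Act (D : Gens A) (S : Submodule R A) (t : ℕ) (a : A) : Prop :=
  (D.X t : A) * a ∈ S ∧ D.E t * a ∈ S

namespace IsBMW

variable (H : D.IsBMW N δ lam h h')
include H

theorem act_of_lt {l t i j : ℕ} {r : ℤ} {Adm : ℕ → ℤ → Prop} (hl : l ≤ N) (ht : 1 ≤ t)
    (hi : t + 1 < i) (hij : i ≤ j) (hj : j ≤ l) (hr : Adm i r) :
    D.Act (D.Sp R l Adm) t (D.al i j l r) := by
  have h0 : D.al i j l r ∈ D.Sp R l Adm := al_mem_Sp (by omega) hij hj hr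
  have hX : (D.X t : A) ∈ D.C R (i - 1) := X_mem_C ht (by omega)
  have hE : D.E t ∈ D.C R (i - 1) := E_mem_C ht (by omega)
  have key : ∀ c ∈ D.C R (i - 1), c * D.al i j l r ∈ D.Sp R l Adm := by
    intro c hc
    have h1 := coe_zpow_comm (H.YU_succ_comm_C (i := i) (by omega) (by omega) c hc) r
    have h2 := H.bet_comm_C (i := i) (j := j) (l := l) (by omega) hij (by omega) hl c hc
    rw [al, (h1.symm.mul_right h2.symm).eq]
    exact Sp_mul_mem h0 (C_mono (by omega) hc)
  exact ⟨key _ hX, key _ hE⟩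

theorem act_of_gt {l t i j : ℕ} {r : ℤ} {Adm : ℕ → ℤ → Prop} (hl : l ≤ N)
    (hi : 1 ≤ i) (hit : i < t) (ht : t ≤ l) (hij : i ≤ j) (hj : j ≤ l) (hr : Adm i r)
    (h0 : ∀ i', i < i' → Adm i' 0) :
    D.Act (D.Sp R l Adm) t (D.al i j l r) := by
  set S := D.Sp R l Adm
  have hX : Commute (D.X t : A) ((D.YU i ^ r : Aˣ) : A) :=
    (coe_zpow_comm (Commute.units_val (H.X_comm_YU_of_lt hi hit (by omega))).symm r).symm
  have hE : Commute (D.E t) ((D.YU i ^ r : Aˣ) : A) :=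
    (coe_zpow_comm (H.E_comm_YU_of_lt hi hit (by omega)).symm r).symm
  have hal : ∀ j', i ≤ j' → j' ≤ l → ((D.YU i ^ r : Aˣ) : A) * D.bet i j' l ∈ S :=
    fun j' h1 h2 => al_mem_Sp hi h1 h2 hr
  have hes : ∀ j', i ≤ j' → j' + 1 ≤ l →
      ((D.YU i ^ r : Aˣ) : A) * (D.Es (j' + 1) l * D.Xs i j') ∈ S := by
    intro j' h1 h2
    have h3 := H.Es_comm_C (j := j' + 1) (l := l) (m := i) (by omega) hl _
      (YU_zpow_mem_C (D := D) (R := R) hi le_rfl r)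
    rw [← mul_assoc, ← h3.eq, mul_assoc, ← D.bet_self, ← D.al_zero]
    exact Sp_mul_mem (al_mem_Sp (by omega) le_rfl h2 (h0 _ (by omega)))
      (mul_mem (YU_zpow_mem_C hi (by omega) r) (Xs_mem_C hi (by omega)))
  unfold Act
  rw [al, ← mul_assoc, ← mul_assoc, hX.eq, hE.eq, mul_assoc, mul_assoc]
  obtain ⟨s, rfl⟩ := Nat.exists_eq_add_of_le' (show 1 ≤ t by omega)
  rcases lt_trichotomy (s + 1) j with h1 | rfl | h1
  · rw [H.X_mul_bet_of_lt hi (by omega) h1 hj hl, H.E_mul_bet_of_lt hi (by omega) h1 hj hl,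
      ← mul_assoc, ← mul_assoc]
    exact ⟨Sp_mul_mem (hal j hij hj) (X_mem_C (by omega) (by omega)),
      Sp_mul_mem (hal j hij hj) (E_mem_C (by omega) (by omega))⟩
  · rw [H.X_mul_bet_succ hi (by omega) hj hl, H.E_succ_mul_bet_succ hi (by omega) hj hl,
      mul_smul_comm]
    exact ⟨hal s (by omega) (by omega), S.smul_mem _ (hes s (by omega) hj)⟩
  · rcases Nat.lt_or_ge j s with h2 | h2
    · obtain ⟨s, rfl⟩ := Nat.exists_eq_add_of_le' (show 1 ≤ s by omega)
      rw [H.X_mul_bet_of_gt hi hij (by omega) ht hl, H.E_mul_bet_of_gt hi hij (by omega) ht hl,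
        ← mul_assoc, ← mul_assoc]
      exact ⟨Sp_mul_mem (hal j hij hj) (X_mem_C (by omega) (by omega)),
        Sp_mul_mem (hal j hij hj) (E_mem_C (by omega) (by omega))⟩
    · obtain rfl : s = j := by omega
      have he := hes s hij ht
      rw [(H.localRel (i := s + 1) (by omega) (by omega)).x_eq]
      simp only [sub_mul, add_mul, smul_mul_assoc, one_mul, mul_add, mul_sub, mul_smul_comm]
      rw [H.Xi_mul_bet hi hij ht hl, H.E_succ_mul_bet hi hij ht hl]
      exact ⟨S.sub_mem (S.add_mem (hal _ (by omega) ht) (S.smul_mem _ (hal s hij hj)))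
        (S.smul_mem _ he), he⟩

theorem act_pred {l i j : ℕ} {r : ℤ} {Adm : ℕ → ℤ → Prop} (hl : l ≤ N)
    (hi : 1 ≤ i) (hij : i + 1 ≤ j) (hj : j ≤ l)
    (h1 : ∀ p, Btw r p → Adm i p) (h2 : ∀ p, Btw r p → Adm (i + 1) p) :
    D.Act (D.Sp R l Adm) i (D.al (i + 1) j l r) := by
  have hc := fun c hc => H.bet_comm_C (m := i) (i := i + 1) (j := j) (l := l) le_rfl hij
    (by omega) hl c hc
  refine (H.localRel hi (by omega)).x_zpow_mem (β := D.bet (i + 1) j l) (S := D.Sp R l Adm)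
    (hc _ (YU_mem_C hi le_rfl).1).symm
    (fun s hs p => Sp_mul_mem hs (YU_zpow_mem_C hi (by omega) p)) r ?_ ?_ ?_
  · intro p hp
    rw [← D.bet_head (by omega)]
    exact al_mem_Sp hi (by omega) hj (h1 p hp)
  · intro p hp
    exact al_mem_Sp (by omega) hij hj (h2 p hp)
  · intro p hp
    obtain ⟨c, hc, h3⟩ := H.E_mul_bet hi hij hj hl
    rw [h3, ← mul_assoc, ← D.bet_self]
    exact Sp_mul_mem (al_mem_Sp hi le_rfl (by omega) (h1 p hp)) hc

theorem YU_E_YU_Es_mem {l i : ℕ} {S : Submodule R A} (hl : l ≤ N) (hi : 1 ≤ i) (hil : i ≤ l)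
    (hS : ∀ s ∈ S, ∀ c ∈ D.C R (l - 1), s * c ∈ S) {q : ℤ} (hq : D.al i i l q ∈ S) (p : ℤ)
    {c : A} (hc : c ∈ D.C R (l - 1)) :
    ((D.YU i ^ q : Aˣ) : A) * (D.E i * (((D.YU i ^ p : Aˣ) : A) * (D.Es i l * c))) ∈ S := by
  obtain ⟨d, hd, h1⟩ := H.E_YU_zpow_E hi (by omega) p
  have h2 := (H.Es_comm_C (j := i + 1) (l := l) (by omega) hl d hd).eq
  have : D.E i * (((D.YU i ^ p : Aˣ) : A) * (D.Es i l * c)) = D.Es i l * (d * c) := by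
    rw [D.Es_head hil, mul_assoc, ← mul_assoc _ (D.E i), mul_mul_of_eq h1]
    simp only [mul_assoc]
    rw [← mul_assoc d, ← h2, mul_assoc]
  rw [this, ← mul_assoc, ← D.bet_self]
  exact hS _ hq _ (mul_mem (C_mono (by omega) hd) hc)

theorem act_self {l i j : ℕ} {r : ℤ} {Adm : ℕ → ℤ → Prop} (hl : l ≤ N)
    (hi : 1 ≤ i) (hij : i ≤ j) (hj : j ≤ l)
    (h1 : i < j → ∀ p, Btw r p → Adm i p) (h2 : i < j → ∀ p, Btw r p → Adm (i + 1) p)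
    (h3 : ∀ p : ℤ, |p| ≤ |r| → D.al i i l p ∈ D.Sp R l Adm) :
    D.Act (D.Sp R l Adm) i (D.al i j l r) := by
  have hmul : ∀ s ∈ D.Sp R l Adm, ∀ c ∈ D.C R (l - 1), s * c ∈ D.Sp R l Adm :=
    fun s hs c hc => Sp_mul_mem hs hc
  have hrel := H.localRel hi (by omega)
  rcases hij.eq_or_lt with rfl | hij
  · have h4 : D.Es i l = D.E i * D.Es (i + 1) l := D.Es_head hj
    have := hrel.x_ypow_e_mem (S := D.Sp R l Adm) (β := D.Es (i + 1) l) r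
      (fun p hp => by
        rw [← h4, ← D.bet_self]; exact h3 p hp)
      (fun q p hq => by
        have := H.YU_E_YU_Es_mem hl hi hj hmul (h3 q hq) p (one_mem _)
        rwa [mul_one, h4] at this)
    rw [← h4, ← D.bet_self] at this
    exact ⟨this.1, this.2.2⟩
  · have hc := fun c hc => H.bet_comm_C (m := i) (i := i + 1) (j := j) (l := l) le_rfl hij
      (by omega) hl c hc
    obtain ⟨c, hcC, h4⟩ := H.E_mul_bet hi hij hj hl
    rw [Act, al, D.bet_head hij]
    refine hrel.x_ypow_x_mem (β := D.bet (i + 1) j l) (S := D.Sp R l Adm)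
      (hc _ (YU_mem_C hi le_rfl).1).symm
      (fun s hs p => Sp_mul_mem hs (YU_zpow_mem_C hi (by omega) p)) r ?_ ?_ ?_ ?_
    · intro p hp
      rw [← D.bet_head hij]
      exact al_mem_Sp hi hij.le hj (h1 hij p hp)
    · intro p hp
      exact al_mem_Sp (by omega) hij hj (h2 hij p hp)
    · intro p hp
      rw [h4, ← mul_assoc, ← D.bet_self]
      exact hmul _ (h3 p hp) _ hcC
    · intro q p hq
      rw [h4]
      exact H.YU_E_YU_Es_mem hl hi (by omega) hmul (h3 q hq) p hcC

end IsBMW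

theorem mul_mem_Sp {l : ℕ} {Adm : ℕ → ℤ → Prop} {S : Submodule R A} {x a : A}
    (hS : ∀ s ∈ S, ∀ c ∈ D.C R (l - 1), s * c ∈ S)
    (hx : ∀ i j r, 1 ≤ i → i ≤ j → j ≤ l → Adm i r → x * D.al i j l r ∈ S)
    (ha : a ∈ D.Sp R l Adm) : x * a ∈ S := by
  induction ha using Submodule.span_induction with
  | mem _ hb =>
    obtain ⟨i, j, r, c, hc, h1, h2, h3, h4, rfl⟩ := hb
    rw [← mul_assoc]
    exact hS _ (hx i j r h1 h2 h3 h4) c hc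
  | zero => rw [mul_zero]; exact zero_mem _
  | add b b' _ _ hb hb' => rw [mul_add]; exact add_mem hb hb'
  | smul r b _ hb => rw [mul_smul_comm]; exact Submodule.smul_mem _ _ hb

theorem act_mem_Sp {l t : ℕ} {Adm : ℕ → ℤ → Prop}
    (hx : ∀ i j r, 1 ≤ i → i ≤ j → j ≤ l → Adm i r → D.Act (D.Sp R l Adm) t (D.al i j l r)) :
    ∀ a ∈ D.Sp R l Adm, D.Act (D.Sp R l Adm) t a := fun _ ha =>
  ⟨mul_mem_Sp (fun _ hs _ hc => Sp_mul_mem hs hc)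
      (fun i j r h1 h2 h3 h4 => (hx i j r h1 h2 h3 h4).1) ha,
    mul_mem_Sp (fun _ hs _ hc => Sp_mul_mem hs hc)
      (fun i j r h1 h2 h3 h4 => (hx i j r h1 h2 h3 h4).2) ha⟩

theorem C_mul_mem {m : ℕ} {S : Submodule R A}
    (hy : 1 ≤ m → ∀ a ∈ S, (D.y : A) * a ∈ S ∧ (↑D.y⁻¹ : A) * a ∈ S)
    (hX : ∀ i, 1 ≤ i → i + 1 ≤ m → ∀ a ∈ S,
      (D.X i : A) * a ∈ S ∧ (↑(D.X i)⁻¹ : A) * a ∈ S ∧ D.E i * a ∈ S)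
    {c : A} (hc : c ∈ D.C R m) : ∀ a ∈ S, c * a ∈ S := by
  induction hc using Algebra.adjoin_induction with
  | mem x hx =>
    rcases hx with ⟨h1, rfl | rfl⟩ | ⟨i, h1, h2, rfl | rfl | rfl⟩
    · exact fun a ha => (hy h1 a ha).1
    · exact fun a ha => (hy h1 a ha).2
    · exact fun a ha => (hX i h1 h2 a ha).1
    · exact fun a ha => (hX i h1 h2 a ha).2.1
    · exact fun a ha => (hX i h1 h2 a ha).2.2
  | algebraMap r => intro a ha; rw [← Algebra.smul_def]; exact S.smul_mem r ha
  | add x y _ _ hx hy => intro a ha; rw [add_mul]; exact S.add_mem (hx a ha) (hy a ha)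
  | mul x y _ _ hx hy => intro a ha; rw [mul_assoc]; exact hx _ (hy a ha)

namespace IsBMW

variable (H : D.IsBMW N δ lam h h')
include H

theorem Xi_mul_mem_of_act {S : Submodule R A} {t : ℕ} (ht : 1 ≤ t) (htN : t ≤ N) {a : A}
    (ha : a ∈ S) (h1 : D.Act S t a) : (↑(D.X t)⁻¹ : A) * a ∈ S :=
  ((H.localRel ht htN).x_mul_mem_iff ha h1.2).1 h1.1

theorem y_zpow_mul_mem {l : ℕ} (hl : l ≤ N) (p : ℤ) :
    ∀ a ∈ D.Sp R l fun _ r => -h ≤ r ∧ r ≤ h',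
      ((D.y ^ p : Aˣ) : A) * a ∈ D.Sp R l fun _ r => -h ≤ r ∧ r ≤ h' := by
  intro a ha
  refine mul_mem_Sp (fun _ hs _ hc => Sp_mul_mem hs hc) (fun i j r h1 h2 h3 h4 => ?_) ha
  rcases h1.eq_or_lt with rfl | h1
  · rw [al, YU_one, coe_zpow_mul]
    have h5 := H.cyc (p + r)
    generalize ((D.y ^ (p + r) : Aˣ) : A) = z at h5 ⊢
    induction h5 using Submodule.span_induction with
    | mem x hx =>
      obtain ⟨s, h6, h7, rfl⟩ := hx
      exact al_mem_Sp le_rfl h2 h3 ⟨h6, h7⟩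
    | zero => rw [zero_mul]; exact zero_mem _
    | add x y _ _ hx hy => rw [add_mul]; exact add_mem hx hy
    | smul a x _ hx => rw [smul_mul_assoc]; exact Submodule.smul_mem _ _ hx
  · have hc : ((D.y ^ p : Aˣ) : A) ∈ D.C R 1 := YU_zpow_mem_C (i := 1) le_rfl le_rfl p
    have h5 := coe_zpow_comm (H.YU_succ_comm_C (i := i) h1 (by omega) _ hc) r
    have h6 := H.bet_comm_C (i := i) (j := j) (l := l) h1 h2 (by omega) hl _ hc
    rw [al, (h5.symm.mul_right h6.symm).eq]
    exact Sp_mul_mem (al_mem_Sp (by omega) h2 h3 h4) (C_mono (by omega) hc)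

theorem C_mul_mem_Sp {l : ℕ} (hl : l ≤ N) {m : ℕ} (hm : m ≤ l + 1) :
    ∀ c ∈ D.C R m, ∀ a ∈ D.Sp R l fun _ r => -h ≤ r ∧ r ≤ h',
      c * a ∈ D.Sp R l fun _ r => -h ≤ r ∧ r ≤ h' := by
  induction m with
  | zero =>
    exact fun c hc => C_mul_mem (fun h1 => absurd h1 (by omega))
      (fun i h1 h2 => absurd h2 (by omega)) hc
  | succ t ih =>
    refine fun c hc => C_mul_mem (fun _ a ha => ?_) (fun i hi hi' a ha => ?_) hc
    · have h1 := H.y_zpow_mul_mem hl 1 a ha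
      have h2 := H.y_zpow_mul_mem hl (-1) a ha
      rw [zpow_one] at h1
      rw [zpow_neg_one] at h2
      exact ⟨h1, h2⟩
    · have h0 := H.h_nonneg
      have h0' := H.h_le
      have key := act_mem_Sp (D := D) (R := R) (l := l) (t := i)
        (Adm := fun _ r => -h ≤ r ∧ r ≤ h') (fun i' j r h1 h2 h3 h4 => by
          have hb : ∀ p, Btw r p → -h ≤ p ∧ p ≤ h' := by unfold Btw; omega
          rcases lt_trichotomy (i + 1) i' with h5 | rfl | h5
          · exact H.act_of_lt hl hi h5 h2 h3 h4
          · exact H.act_pred hl hi h2 h3 hb hb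
          · rcases (Nat.lt_succ_iff.1 h5).eq_or_lt with rfl | h5
            · refine H.act_self hl h1 h2 h3 (fun _ => hb) (fun _ => hb) fun p _ => ?_
              refine ih (by omega) _ (YU_zpow_mem_C hi (by omega) p) _ ?_
              rw [← D.al_zero]
              exact al_mem_Sp hi le_rfl (by omega) (by omega)
            · exact H.act_of_gt hl h1 h5 (by omega) h2 h3 h4 fun _ _ => by omega) a ha
      exact ⟨key.1, H.Xi_mul_mem_of_act hi (by omega) ha key, key.2⟩

theorem C_mul_E_mem_Sp {l : ℕ} (h1 : 1 ≤ l) (hl : l ≤ N) {c : A} (hc : c ∈ D.C R (l + 1)) :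
    c * D.E l ∈ D.Sp R l fun _ r => -h ≤ r ∧ r ≤ h' := by
  have h0 := H.h_nonneg
  have h0' := H.h_le
  refine H.C_mul_mem_Sp hl le_rfl c hc _ ?_
  rw [← D.Es_self, ← D.bet_self, ← D.al_zero]
  exact al_mem_Sp h1 le_rfl le_rfl (by omega)

theorem act_Sp_abs_le {l i t : ℕ} (hl : l ≤ N) (hi : 1 ≤ i) (hit : i ≤ t) (ht : t ≤ l) :
    ∀ a ∈ D.Sp R l fun i' r => i ≤ i' ∧ |r| ≤ h,
      D.Act (D.Sp R l fun i' r => i ≤ i' ∧ |r| ≤ h) t a := by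
  have h0 := H.h_nonneg
  refine act_mem_Sp fun i' j r h1 h2 h3 h4 => ?_
  have hb : ∀ p, Btw r p → |p| ≤ h := by
    intro p hp
    rw [abs_le] at h4 ⊢
    unfold Btw at hp
    omega
  rcases lt_trichotomy (t + 1) i' with h5 | rfl | h5
  · exact H.act_of_lt hl (by omega) h5 h2 h3 h4
  · exact H.act_pred hl (by omega) h2 h3 (fun p hp => ⟨hit, hb p hp⟩)
      fun p hp => ⟨by omega, hb p hp⟩
  · rcases (Nat.lt_succ_iff.1 h5).eq_or_lt with rfl | h5
    · exact H.act_self hl h1 h2 h3 (fun _ p hp => ⟨hit, hb p hp⟩)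
        (fun _ p hp => ⟨by omega, hb p hp⟩)
        fun p hp => al_mem_Sp h1 le_rfl ht ⟨hit, hp.trans h4.2⟩
    · exact H.act_of_gt hl h1 h5 ht h2 h3 h4 fun _ _ => ⟨by omega, by simpa using h0⟩

theorem act_Sp_of_lt {l i t : ℕ} {r : ℤ} (hl : l ≤ N) (hi : 1 ≤ i) (hit : i < t) (ht : t ≤ l) :
    ∀ a ∈ D.Sp R l fun i' u => (i' = i ∧ u = r) ∨ (i ≤ i' ∧ |u| ≤ h),
      D.Act (D.Sp R l fun i' u => (i' = i ∧ u = r) ∨ (i ≤ i' ∧ |u| ≤ h)) t a := by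
  have h0 := H.h_nonneg
  refine act_mem_Sp fun i' j u h1 h2 h3 h4 => ?_
  rcases h4 with ⟨rfl, rfl⟩ | h4
  · exact H.act_of_gt hl h1 hit ht h2 h3 (Or.inl ⟨rfl, rfl⟩)
      fun _ _ => Or.inr ⟨by omega, by simpa using h0⟩
  · have := H.act_Sp_abs_le hl hi hit.le ht _ (al_mem_Sp h1 h2 h3 h4)
    exact ⟨Sp_mono (fun _ _ => Or.inr) this.1, Sp_mono (fun _ _ => Or.inr) this.2⟩

theorem Xi_mul_al_succ_mem {l i j : ℕ} {r : ℤ} (hl : l ≤ N) (hi : 1 ≤ i) (hij : i + 1 ≤ j)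
    (hj : j ≤ l) (hr : -h ≤ r) (hr' : r ≤ h') :
    (↑(D.X i)⁻¹ : A) * D.al (i + 1) j l r ∈
      D.Sp R l fun i' u => (i' = i ∧ u = r) ∨ (i ≤ i' ∧ |u| ≤ h) := by
  have h0 := H.h_nonneg
  have h0' := H.le_h
  rcases le_or_gt |r| h with h1 | h1
  · have h2 : D.al (i + 1) j l r ∈ D.Sp R l fun i' r => i ≤ i' ∧ |r| ≤ h :=
      al_mem_Sp (by omega) hij hj ⟨by omega, h1⟩
    exact Sp_mono (fun _ _ => Or.inr) (H.Xi_mul_mem_of_act hi (by omega) h2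
      (H.act_Sp_abs_le hl hi le_rfl (by omega) _ h2))
  · obtain rfl : r = h + 1 := by
      rcases abs_cases r with h2 | h2 <;> omega
    obtain ⟨n, rfl⟩ := Int.eq_ofNat_of_zero_le h0
    have hc := fun c hc => H.bet_comm_C (m := i) (i := i + 1) (j := j) (l := l) le_rfl hij
      (by omega) hl c hc
    refine (H.localRel hi (by omega)).xi_zpow_succ_mem (β := D.bet (i + 1) j l)
      (S := D.Sp R l _) (hc _ (YU_mem_C hi le_rfl).1).symm
      (fun s hs p => Sp_mul_mem hs (YU_zpow_mem_C hi (by omega) p)) n ?_ ?_ ?_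
    · rw [← D.bet_head (by omega)]
      exact al_mem_Sp hi (by omega) hj (Or.inl ⟨rfl, rfl⟩)
    · intro p hp hp'
      exact al_mem_Sp (by omega) hij hj (Or.inr ⟨by omega, by rwa [abs_of_nonneg hp]⟩)
    · intro p hp hp'
      obtain ⟨c, hc, h3⟩ := H.E_mul_bet hi hij hj hl
      rw [h3, ← mul_assoc, ← D.bet_self]
      exact Sp_mul_mem (al_mem_Sp hi le_rfl (by omega)
        (Or.inr ⟨le_rfl, by rwa [abs_of_nonneg hp]⟩)) hc

theorem YU_mul_Es {i l g : ℕ} (hi : 1 ≤ i) (hig : i ≤ g) (hgl : g + 2 ≤ l) (hl : l ≤ N) :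
    (D.YU (g + 2) : A) * D.Es i l = D.Es i l * D.YU g := by
  have h1 : Commute (D.YU (g + 2) : A) (D.Es i g) := commute_Es fun t _ _ =>
    (H.E_comm_YU (by omega) (by omega) (by omega) (by omega) (by omega)).symm
  have h2 : Commute (D.YU g : A) (D.Es (g + 2) l) := (H.Es_comm_C (m := g) (by omega) hl _
    (YU_mem_C (by omega) le_rfl).1).symm
  have h3 : (D.YU (g + 2) : A) * (D.E g * D.E (g + 1)) = D.E g * (D.E (g + 1) * D.YU g) := by
    have h4 : Commute (D.YU (g + 2) : A) (D.E g) :=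
      (H.E_comm_YU (by omega) (by omega) (by omega) (by omega) (by omega)).symm
    have h5 : Commute (D.E (g + 1)) (D.YU g : A) :=
      H.E_comm_YU (by omega) (by omega) (by omega) (by omega) (by omega)
    have h6 := (H.localRel (i := g + 1) (by omega) (by omega)).zpow_e 1
    have h7 := (H.localRel (i := g) (by omega) (by omega)).e_zpow (-1)
    rw [zpow_one] at h6
    rw [neg_neg, zpow_one] at h7
    rw [h4.left_comm, h6, ← mul_assoc, h7, h5.eq, mul_assoc]
  rw [← D.Es_mul_Es (j := i) (k := g + 1) (by omega) (by omega), D.Es_succ (by omega)]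
  obtain ⟨s, rfl⟩ := Nat.exists_eq_add_of_le' (hi.trans hig)
  have h8 : Commute (D.YU (s + 1 + 2) : A) (D.Es i s) := commute_Es fun t _ _ =>
    (H.E_comm_YU (by omega) (by omega) (by omega) (by omega) (by omega)).symm
  rw [D.Es_succ (by omega)]
  simp only [mul_assoc]
  rw [← h2.eq, h8.left_comm, ← mul_assoc (D.E (s + 1)), ← mul_assoc (D.YU (s + 1 + 2) : A), h3]
  simp only [mul_assoc]

theorem YU_zpow_mul_Es {i l g : ℕ} (hi : 1 ≤ i) (hig : i ≤ g) (hgl : g + 2 ≤ l) (hl : l ≤ N)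
    (p : ℤ) : ((D.YU (g + 2) ^ p : Aˣ) : A) * D.Es i l = D.Es i l * ((D.YU g ^ p : Aˣ) : A) := by
  have h1 : SemiconjBy (D.Es i l) (D.YU g : A) (D.YU (g + 2) : A) :=
    (H.YU_mul_Es hi hig hgl hl).symm
  exact (h1.units_zpow_right p).eq.symm

theorem Es_mul_Es_sub_two {i g l : ℕ} (hi : 1 ≤ i) (hig : i ≤ g) (hgl : g ≤ l)
    (hl : l + 2 ≤ N) :
    D.Es i (l + 2) * D.Es g l = D.Es (g + 2) (l + 2) * D.Es i l := by
  have h1 : ∀ k, g ≤ k + 1 → k ≤ l →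
      D.Es i (l + 2) * D.Es g k = D.Es (g + 2) (k + 2) * D.Es i (l + 2) := by
    intro k hk hkl
    induction k with
    | zero =>
      obtain rfl : g = 0 + 1 := by omega
      rw [D.Es_eq_one, D.Es_eq_one, mul_one, one_mul]
    | succ k ih =>
      rcases hk.eq_or_lt with rfl | hk
      · rw [D.Es_eq_one, show k + 1 + 1 + 2 = k + 1 + 2 + 1 by omega, D.Es_eq_one, mul_one, one_mul]
      · rw [D.Es_succ (j := g) (l := k) (by omega), ← mul_assoc, ih (by omega) (by omega), mul_assoc,
          ← H.E_mul_Es hi (by omega) (by omega) hl, ← mul_assoc,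
          show k + 1 + 2 = k + 2 + 1 by omega, D.Es_succ (j := g + 2) (l := k + 2) (by omega)]
  rw [h1 l (by omega) le_rfl, D.Es_succ (l := l + 1) (by omega), D.Es_succ (l := l + 1) (by omega),
    D.Es_succ (l := l) (j := i) (by omega)]
  have h2 : Commute (D.E (l + 2)) (D.Es i l) := commute_Es fun u hu hu' =>
    H.E_comm_E (by omega) (by omega) (by omega) (by omega) (by omega)
  simp only [mul_assoc]
  rw [h2.left_comm, H.EEE_down (l + 1) (by omega) (by omega), ← h2.eq]

theorem Es_mul_bet {i g k l : ℕ} (hi : 1 ≤ i) (hig : i ≤ g) (hgk : g ≤ k) (hk : k ≤ l)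
    (hl : l + 2 ≤ N) :
    D.Es i (l + 2) * D.bet g k l = D.bet (g + 2) (k + 2) (l + 2) * D.Es i l := by
  have h1 : D.Es i (l + 2) * (D.Xs g k : A) = D.Xs (g + 2) (k + 2) * D.Es i (l + 2) := by
    induction k, hgk using Nat.le_induction with
    | base => simp [Xs_self]
    | succ k hgk ih =>
      rw [D.Xs_succ hgk, show k + 1 + 2 = k + 2 + 1 by omega, D.Xs_succ (by omega), Units.val_mul,
        ← mul_assoc, ih (by omega), mul_assoc, ← H.X_mul_Es hi (by omega) (by omega) hl,
        Units.val_mul, mul_assoc]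
  rw [bet, bet, ← mul_assoc, h1, mul_assoc, H.Es_mul_Es_sub_two hi (by omega) hk hl, mul_assoc]

/-- Two consecutive chains with weakly increasing first indices can be rewritten so that the
first index of the left one increases. -/
theorem al_mul_al_mem {i j g k l : ℕ} {p r : ℤ} (hi : 1 ≤ i) (hij : i ≤ j) (hj : j ≤ l + 2)
    (hig : i ≤ g) (hgk : g ≤ k) (hk : k ≤ l) (hl : l + 2 ≤ N) (hr : -h ≤ r) (hr' : r ≤ h') :
    ∃ s ∈ D.Sp R (l + 2) fun i' u => i < i' ∧ -h ≤ u ∧ u ≤ h',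
      D.al i j (l + 2) p * D.al g k l r = s * D.al i i l p := by
  have h0 := H.h_le
  have hcomm : ∀ a ∈ D.C R (g + 1), Commute a (D.al (g + 2) (k + 2) (l + 2) r) := fun a ha =>
    ((coe_zpow_comm (H.YU_succ_comm_C (i := g + 2) (by omega) (by omega) a ha) r).mul_left
      (H.bet_comm_C (i := g + 2) (by omega) (by omega) (by omega) hl a ha)).symm
  have hstep : ∀ j, i ≤ j → j + 1 ≤ l + 2 → ∀ s, D.al i j (l + 2) p * D.al g k l r =
      s * D.al i i l p →
      D.al i (j + 1) (l + 2) p * D.al g k l r = ↑(D.X (j + 1))⁻¹ * s * D.al i i l p := by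
    intro j hij hj s hs
    have h1 : Commute (((D.YU i ^ p : Aˣ) : A)) (↑(D.X (j + 1))⁻¹ : A) :=
      coe_zpow_comm (Commute.units_inv_right
        (Commute.units_val (H.X_comm_YU_of_lt hi (by omega) (by omega))).symm) p
    rw [mul_assoc, ← hs, al, ← H.Xi_mul_bet hi hij hj hl, h1.left_comm, mul_assoc, ← al]
  have hle : ∀ j, i ≤ j → j ≤ g → ∃ c ∈ D.C R (l + 1), D.al i j (l + 2) p * D.al g k l r =
      D.al (g + 2) (k + 2) (l + 2) r * c * D.al i i l p := by
    intro j hij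
    induction j, hij using Nat.le_induction with
    | base =>
      intro _
      have h1 := hcomm _ (YU_zpow_mem_C (D := D) hi (by omega) p)
      refine ⟨1, one_mem _, ?_⟩
      rw [mul_one, al, al, bet_self, mul_assoc, ← mul_assoc (D.Es i (l + 2)),
        ← H.YU_zpow_mul_Es hi hig (by omega) hl, mul_assoc, H.Es_mul_bet hi hig hgk hk hl,
        ← mul_assoc _ (D.bet _ _ _), ← al, ← mul_assoc, h1.eq, al.eq_def D i i, bet_self, mul_assoc]
    | succ j hij ih =>
      intro hjg
      obtain ⟨c, hc, h1⟩ := ih (by omega)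
      have hX : (↑(D.X (j + 1))⁻¹ : A) ∈ D.C R (g + 1) := Xi_mem_C (by omega) (by omega)
      refine ⟨↑(D.X (j + 1))⁻¹ * c, mul_mem (C_mono (by omega) hX) hc, ?_⟩
      rw [hstep j hij (by omega) _ h1, ← mul_assoc, (hcomm _ hX).eq]
      simp only [mul_assoc]
  have hgt : ∀ j, g + 1 ≤ j → j ≤ l + 2 →
      ∃ s ∈ D.Sp R (l + 2) fun i' u => (i' = g + 1 ∧ u = r) ∨ (g + 1 ≤ i' ∧ |u| ≤ h),
        D.al i j (l + 2) p * D.al g k l r = s * D.al i i l p := by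
    intro j hgj
    induction j, hgj using Nat.le_induction with
    | base =>
      intro _
      obtain ⟨c, hc, h1⟩ := hle g hig le_rfl
      refine ⟨_, ?_, hstep g hig (by omega) _ h1⟩
      rw [← mul_assoc]
      exact Sp_mul_mem (H.Xi_mul_al_succ_mem hl (by omega) (by omega) (by omega) hr hr') hc
    | succ j hgj ih =>
      intro hj
      obtain ⟨s, hs, h1⟩ := ih (by omega)
      exact ⟨_, H.Xi_mul_mem_of_act (by omega) (by omega) hs
        (H.act_Sp_of_lt hl (by omega) (by omega) hj _ hs), hstep j (by omega) hj _ h1⟩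
  rcases le_or_gt j g with h1 | h1
  · obtain ⟨c, hc, h2⟩ := hle j hij h1
    exact ⟨_, Sp_mul_mem (al_mem_Sp (by omega) (by omega) (by omega) ⟨by omega, hr, hr'⟩) hc, h2⟩
  · obtain ⟨s, hs, h2⟩ := hgt j h1 hj
    refine ⟨s, Sp_mono (fun i' u hu => ?_) hs, h2⟩
    rw [abs_le] at hu
    omega

end IsBMW

theorem Sp_mul_mem_of {l : ℕ} {Adm : ℕ → ℤ → Prop} {S : Submodule R A} {a u : A}
    (ha : a ∈ D.Sp R l Adm)
    (hu : ∀ i j r, 1 ≤ i → i ≤ j → j ≤ l → Adm i r → ∀ c ∈ D.C R (l - 1),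
      D.al i j l r * (c * u) ∈ S) : a * u ∈ S := by
  induction ha using Submodule.span_induction with
  | mem _ hb =>
    obtain ⟨i, j, r, c, hc, h1, h2, h3, h4, rfl⟩ := hb
    rw [mul_assoc]
    exact hu i j r h1 h2 h3 h4 c hc
  | zero => rw [zero_mul]; exact zero_mem _
  | add b b' _ _ hb hb' => rw [add_mul]; exact add_mem hb hb'
  | smul r b _ hb => rw [smul_mul_assoc]; exact Submodule.smul_mem _ _ hb

variable (D) in
/-- `e_{l-1} e_{l-3} ⋯ e_{l-2m+1}`. -/
def EE : ℕ → ℕ → A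
  | 0, _ => 1
  | m + 1, l => D.E (l - 1) * EE m (l - 2)

variable (D) in
/-- The products of `m` chains `al i₁ j₁ (l-2) s₁`, `al i₂ j₂ (l-4) s₂`, … with
`b > i₁ > i₂ > ⋯` and exponents in `[-h, h']`. -/
def VB (h h' : ℤ) : ℕ → ℕ → ℕ → Set A
  | 0, _, _ => {1}
  | m + 1, l, b => {a | ∃ i j s, ∃ v ∈ VB h h' m (l - 2) i, 1 ≤ i ∧ i < b ∧ i ≤ j ∧ j ≤ l - 1 ∧
      -h ≤ s ∧ s ≤ h' ∧ a = D.al i j (l - 2) s * v}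

variable (D) in
/-- The right `C_{l-2m}`-module spanned by `VB · EE`. -/
def W (R : Type*) [CommRing R] [Algebra R A] (h h' : ℤ) (m l b : ℕ) : Submodule R A :=
  Submodule.span R {a | ∃ v ∈ D.VB h h' m l b, ∃ c ∈ D.C R (l - 2 * m), a = v * D.EE m l * c}

theorem VB_mem_C {m l b : ℕ} (hm : 2 * m ≤ l) {v : A} (hv : v ∈ D.VB h h' m l b) :
    v ∈ D.C R l := by
  induction m generalizing l b v with
  | zero =>
    obtain rfl : v = 1 := hv
    exact one_mem _
  | succ m ih =>
    obtain ⟨i, j, s, v, hv, h1, h2, h3, h4, h5, h6, rfl⟩ := hv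
    exact mul_mem (al_mem_C h1 h3 (by omega) (by omega) s)
      (C_mono (by omega) (ih (by omega) hv))

namespace IsBMW

variable (H : D.IsBMW N δ lam h h')
include H

theorem EE_comm_C {m l : ℕ} (hm : 2 * m ≤ l) (hl : l ≤ N + 1) :
    ∀ c ∈ D.C R (l - 2 * m), Commute (D.EE m l) c := by
  induction m generalizing l with
  | zero => exact fun c _ => Commute.one_left c
  | succ m ih =>
    intro c hc
    exact (H.E_comm_C (m := l - 2) (by omega) (by omega) c (C_mono (by omega) hc)).mul_left
      (ih (by omega) (by omega) c (C_mono (by omega) hc))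

theorem al_mul_mul_E {i j l : ℕ} {s : ℤ} {v : A} (hj : j ≤ l + 1) (hl : l + 1 ≤ N)
    (hv : v ∈ D.C R l) (a c : A) :
    D.al i j l s * v * (D.E (l + 1) * a) * c = D.al i j (l + 1) s * (v * a * c) := by
  have h1 := (H.E_comm_C (t := l + 1) le_rfl hl v hv).eq
  rw [al, al, bet, bet, D.Es_succ hj]
  simp only [mul_assoc]
  rw [← mul_assoc v, ← h1]
  simp only [mul_assoc]

theorem al_mul_mem_W {i j l m b : ℕ} {s : ℤ} {w : A} (hm : 2 * m ≤ l) (hi : 1 ≤ i) (hib : i < b)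
    (hij : i ≤ j) (hj : j ≤ l + 1) (hl : l + 1 ≤ N) (hs : -h ≤ s) (hs' : s ≤ h')
    (hw : w ∈ D.W R h h' m l i) : D.al i j (l + 1) s * w ∈ D.W R h h' (m + 1) (l + 2) b := by
  induction hw using Submodule.span_induction with
  | mem _ hw =>
    obtain ⟨v, hv, c, hc, rfl⟩ := hw
    refine Submodule.subset_span ⟨_, ⟨i, j, s, v, hv, hi, hib, hij, hj, hs, hs', rfl⟩, c, ?_, ?_⟩
    · rwa [show l + 2 - 2 * (m + 1) = l - 2 * m by omega]
    · exact (H.al_mul_mul_E hj hl (VB_mem_C hm hv) _ _).symm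
  | zero => rw [mul_zero]; exact zero_mem _
  | add b b' _ _ hb hb' => rw [mul_add]; exact add_mem hb hb'
  | smul r b _ hb => rw [mul_smul_comm]; exact Submodule.smul_mem _ _ hb

theorem C_mul_EE_mem_W {m l : ℕ} (hm : 2 * m ≤ l) (hl : l ≤ N + 1) :
    ∀ c ∈ D.C R l, c * D.EE m l ∈ D.W R h h' m l l := by
  induction m generalizing l with
  | zero =>
    intro c hc
    refine Submodule.subset_span ⟨1, rfl, c, hc, ?_⟩
    rw [one_mul]
    exact (Commute.one_right c).eq
  | succ m ih =>
    obtain ⟨l, rfl⟩ := Nat.exists_eq_add_of_le' (show 2 ≤ l by omega)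
    have key : ∀ n i j r, l + 1 < i + n → 1 ≤ i → i ≤ j → j ≤ l + 1 → -h ≤ r ∧ r ≤ h' →
        ∀ w ∈ D.W R h h' m l l,
          D.al i j (l + 1) r * w ∈ D.W R h h' (m + 1) (l + 2) (l + 2) := by
      intro n
      induction n with
      | zero => intro i j r h1 h2 h3 h4; omega
      | succ n ihn =>
        intro i j r h1 h2 h3 h4 h5 w hw
        rcases m with _ | m
        · exact H.al_mul_mem_W (by omega) h2 (by omega) h3 h4 (by omega) h5.1 h5.2 hw
        obtain ⟨l, rfl⟩ := Nat.exists_eq_add_of_le' (show 2 ≤ l by omega)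
        induction hw using Submodule.span_induction with
        | mem _ hw =>
          obtain ⟨_, ⟨g, k, s, v, hv, h6, h7, h8, h9, h10, h11, rfl⟩, c, hc, rfl⟩ := hw
          rcases Nat.lt_or_ge g i with h12 | h12
          · exact H.al_mul_mem_W (by omega) h2 (by omega) h3 h4 (by omega) h5.1 h5.2
              (Submodule.subset_span ⟨_, ⟨g, k, s, v, hv, h6, h12, h8, h9, h10, h11, rfl⟩, c, hc,
                rfl⟩)
          · rw [show l + 2 - 2 * (m + 1) = l - 2 * m by omega] at hc
            have hv' : v ∈ D.C R l := VB_mem_C (by omega) hv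
            have h13 := H.al_mul_mul_E (i := g) (j := k) (l := l) (s := s) h9 (by omega) hv'
              (D.EE m l) c
            have h14 := H.al_mul_mul_E (i := i) (j := i) (l := l) (s := r) (by omega) (by omega)
              hv' (D.EE m l) c
            have h15 := (H.EE_comm_C (m := m + 1) (l := l + 2) (by omega) (by omega) c
              (by rwa [show l + 2 - 2 * (m + 1) = l - 2 * m by omega])).eq
            obtain ⟨a, ha, h16⟩ := H.al_mul_al_mem (i := i) (j := j) (g := g) (k := k)
              (l := l + 1) (p := r) (r := s) h2 h3 h4 h12 h8 h9 (by omega) h10 h11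
            have h17 : D.al i j (l + 3) r * (D.al g k l s * v * D.EE (m + 1) (l + 2) * c) =
                a * (D.al i i l r * v * c * D.EE (m + 1) (l + 2)) := by
              rw [mul_assoc (D.al i i l r * v) c, ← h15, ← mul_assoc (D.al i i l r * v)]
              exact (congrArg (_ * ·) h13).trans ((mul_assoc _ _ _).symm.trans
                ((congrArg (· * _) h16).trans
                ((mul_assoc _ _ _).trans (congrArg (a * ·) h14.symm))))
            change D.al i j (l + 3) r * _ ∈ _
            rw [show l + 2 - 2 = l from rfl, h17]
            refine Sp_mul_mem_of ha fun i' j' u h18 h19 h20 h21 d hd => ?_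
            refine ihn i' j' u (by omega) h18 h19 h20 h21.2 _ ?_
            rw [← mul_assoc]
            refine ih (by omega) (by omega) _ (mul_mem hd (mul_mem (mul_mem ?_ ?_) ?_))
            · exact al_mem_C h2 le_rfl (by omega) (by omega) r
            · exact C_mono (by omega) hv'
            · exact C_mono (by omega) hc
        | zero => rw [mul_zero]; exact zero_mem _
        | add b b' _ _ hb hb' => rw [mul_add]; exact add_mem hb hb'
        | smul r b _ hb => rw [mul_smul_comm]; exact Submodule.smul_mem _ _ hb
    intro c hc
    have h1 := H.C_mul_E_mem_Sp (l := l + 1) (by omega) (by omega) hc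
    have h2 : c * D.EE (m + 1) (l + 2) = c * D.E (l + 1) * D.EE m l := (mul_assoc _ _ _).symm
    rw [h2]
    exact Sp_mul_mem_of h1 fun i j r h3 h4 h5 h6 c hc =>
      key (l + 2) i j r (by omega) h3 h4 h5 h6 _ (ih (by omega) (by omega) c hc)

end IsBMW

end Gens
end Global
section Powers

variable {R A : Type*} [CommRing R] [Ring A] [Algebra R A]

theorem zpow_mem_span_of_pow_eq {u : Aˣ} {k : ℕ} (hk : 1 ≤ k) {q0 : Rˣ} {c : ℕ → R}
    (hc : c 0 = q0) (hu : (u : A) ^ k = ∑ i ∈ Finset.range k, c i • (u : A) ^ i) (a p : ℤ) :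
    ((u ^ p : Aˣ) : A) ∈
      Submodule.span R {x : A | ∃ r : ℤ, a ≤ r ∧ r < a + k ∧ x = ((u ^ r : Aˣ) : A)} := by
  set M := Submodule.span R {x : A | ∃ r : ℤ, a ≤ r ∧ r < a + k ∧ x = ((u ^ r : Aˣ) : A)}
  have hmul : ∀ (b : ℤ) (i : ℕ), ((u ^ b : Aˣ) : A) * (u : A) ^ i = ((u ^ (b + i) : Aˣ) : A) := by
    intro b i
    rw [zpow_add, Units.val_mul, zpow_natCast, Units.val_pow_eq_pow_val]
  have hsum : ∀ b : ℤ, ((u ^ (b + k) : Aˣ) : A) =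
      ∑ i ∈ Finset.range k, c i • ((u ^ (b + i) : Aˣ) : A) := by
    intro b
    rw [← hmul, hu, Finset.mul_sum]
    exact Finset.sum_congr rfl fun i _ => by rw [mul_smul_comm, hmul]
  have hup : ∀ b : ℤ, (∀ r, b ≤ r → r < b + k → ((u ^ r : Aˣ) : A) ∈ M) →
      ((u ^ (b + k) : Aˣ) : A) ∈ M := by
    intro b hb
    rw [hsum]
    exact M.sum_mem fun i hi => M.smul_mem _
      (hb _ (by omega) (by have := Finset.mem_range.1 hi; omega))
  have hdown : ∀ b : ℤ, (∀ r, b ≤ r → r < b + k → ((u ^ r : Aˣ) : A) ∈ M) →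
      ((u ^ (b - 1) : Aˣ) : A) ∈ M := by
    intro b hb
    obtain ⟨k, rfl⟩ := Nat.exists_eq_add_of_le' hk
    have h1 := hsum (b - 1)
    rw [Finset.sum_range_succ', hc, ← sub_eq_iff_eq_add'] at h1
    have h2 : ((q0 : R)) • ((u ^ (b - 1 + (0 : ℕ)) : Aˣ) : A) ∈ M := by
      rw [← h1]
      refine M.sub_mem (hb _ (by push_cast; omega) (by push_cast; omega))
        (M.sum_mem fun i hi => M.smul_mem _ (hb _ (by push_cast; omega) ?_))
      have := Finset.mem_range.1 hi
      push_cast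
      omega
    have h3 := M.smul_mem ((q0⁻¹ : Rˣ) : R) h2
    rwa [smul_smul, Units.inv_mul, one_smul, Nat.cast_zero, add_zero] at h3
  have key : ∀ n : ℕ, ∀ r : ℤ, a - n ≤ r → r < a + k + n → ((u ^ r : Aˣ) : A) ∈ M := by
    intro n
    induction n with
    | zero => exact fun r h1 h2 => Submodule.subset_span ⟨r, by simpa using h1, by simpa using h2, rfl⟩
    | succ n ih =>
      intro r h1 h2
      push_cast at h1 h2
      rcases (show r = a - n - 1 ∨ r = a + n + k ∨ (a - n ≤ r ∧ r < a + k + n) by omega) with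
        rfl | rfl | h3
      · exact hdown _ fun r h1 h2 => ih r h1 (by omega)
      · exact hup _ fun r h1 h2 => ih r (by omega) (by omega)
      · exact ih r h3.1 h3.2
  exact key (p - a).natAbs p (by omega) (by omega)

end Powers

section Presentation

variable {R : Type} [CommRing R] (P : Params R)

theorem pr_eq_of_rel {a b : F R} (h : Rel P a b) : pr P a = pr P b :=
  RingQuot.mkAlgHom_rel R h

theorem Xg_mul_Xgi (i : ℕ) : Xg P i * Xgi P i = 1 := by
  by_cases h : 1 ≤ i ∧ i ≤ P.n - 1
  · simpa [Xg, Xgi] using pr_eq_of_rel P (Rel.X_inv_right h.1 h.2)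
  · have h1 := pr_eq_of_rel P (Rel.X_invalid (i := i) (by omega))
    have h2 := pr_eq_of_rel P (Rel.Xi_invalid (i := i) (by omega))
    rw [Xg, Xgi, h1, h2, map_one, one_mul]

theorem Xgi_mul_Xg (i : ℕ) : Xgi P i * Xg P i = 1 := by
  by_cases h : 1 ≤ i ∧ i ≤ P.n - 1
  · simpa [Xg, Xgi] using pr_eq_of_rel P (Rel.X_inv_left h.1 h.2)
  · have h1 := pr_eq_of_rel P (Rel.X_invalid (i := i) (by omega))
    have h2 := pr_eq_of_rel P (Rel.Xi_invalid (i := i) (by omega))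
    rw [Xg, Xgi, h1, h2, map_one, one_mul]

/-- The generators of the cyclotomic BMW algebra. -/
def gens : Gens (Alg P) where
  X i := ⟨Xg P i, Xgi P i, Xg_mul_Xgi P i, Xgi_mul_Xg P i⟩
  E := Eg P
  y := ⟨Yg P, Ygi P, by simpa [Yg, Ygi] using pr_eq_of_rel P Rel.Y_inv_right,
    by simpa [Yg, Ygi] using pr_eq_of_rel P Rel.Y_inv_left⟩

theorem Yg_pow_eq : Yg P ^ P.k = ∑ i ∈ Finset.range P.k, P.qc i • Yg P ^ i := by
  simpa [Yg] using pr_eq_of_rel P Rel.cyclo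

theorem gens_isBMW (hk : 1 ≤ P.k) (hq0 : P.qc 0 = (P.q0 : R)) :
    (gens P).IsBMW (P.n - 1) P.delta P.lam ((P.k : ℤ) - 1 - (P.k / 2 : ℕ)) (P.k / 2 : ℕ) where
  h_nonneg := by omega
  h_le := by omega
  le_h := by omega
  skein i h1 h2 := by
    have := pr_eq_of_rel P (Rel.skein h1 h2)
    rwa [map_sub, map_smul, map_sub, map_one] at this
  XX_far i j h1 h2 h3 := by
    have := pr_eq_of_rel P (Rel.XX_far h1 (by omega) (by omega) h3 (Or.inl h2))
    rw [map_mul, map_mul] at this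
    exact Units.ext this
  braid i h1 h2 := by
    have := pr_eq_of_rel P (Rel.braid h1 h2)
    simp only [map_mul] at this
    exact Units.ext this
  XE_far i j h1 h2 h3 := by
    have := pr_eq_of_rel P (Rel.XE_far h1 (by omega) (by omega) h3 (Or.inl h2))
    rwa [map_mul, map_mul] at this
  EX_far i j h1 h2 h3 := by
    have := pr_eq_of_rel P (Rel.XE_far (by omega) h3 h1 (by omega) (Or.inr h2))
    rw [map_mul, map_mul] at this
    exact this.symm
  EE_far i j h1 h2 h3 := by
    have := pr_eq_of_rel P (Rel.EE_far h1 (by omega) (by omega) h3 (Or.inl h2))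
    rwa [map_mul, map_mul] at this
  XE i h1 h2 := by
    have := pr_eq_of_rel P (Rel.untwist_right h1 h2)
    rwa [map_mul, map_smul] at this
  EX i h1 h2 := by
    have := pr_eq_of_rel P (Rel.untwist_left h1 h2)
    rwa [map_mul, map_smul] at this
  XXE_up i h1 h2 := by
    have := pr_eq_of_rel P (Rel.XXE h1 (by omega) (by omega) h2 (Or.inl rfl))
    rwa [map_mul, map_mul, map_mul, mul_assoc] at this
  XXE_down i h1 h2 := by
    have := pr_eq_of_rel P (Rel.XXE (by omega) h2 h1 (by omega) (Or.inr rfl))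
    rwa [map_mul, map_mul, map_mul, mul_assoc] at this
  EXX_up i h1 h2 := by
    have := pr_eq_of_rel P (Rel.EXX h1 (by omega) (by omega) h2 (Or.inl rfl))
    rw [map_mul, map_mul, map_mul, mul_assoc] at this
    exact this.symm
  EXX_down i h1 h2 := by
    have := pr_eq_of_rel P (Rel.EXX (by omega) h2 h1 (by omega) (Or.inr rfl))
    rw [map_mul, map_mul, map_mul, mul_assoc] at this
    exact this.symm
  EEE_up i h1 h2 := by
    have := pr_eq_of_rel P (Rel.EEE_up h1 h2)
    rwa [map_mul, map_mul, mul_assoc] at this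
  EEE_down i h1 h2 := by
    have := pr_eq_of_rel P (Rel.EEE_down h1 h2)
    rwa [map_mul, map_mul, mul_assoc] at this
  EE := ⟨P.A 0, fun i h1 h2 => by
    have := pr_eq_of_rel P (Rel.E_sq h1 h2)
    rwa [map_mul, map_smul] at this⟩
  braidB h := by
    have := pr_eq_of_rel P (Rel.braidB (by omega))
    simp only [map_mul] at this
    exact Units.ext this
  yX i h1 h2 := by
    have := pr_eq_of_rel P (Rel.YX_comm h1 h2)
    rw [map_mul, map_mul] at this
    exact Units.ext this
  yE i h1 h2 := by
    have := pr_eq_of_rel P (Rel.YE_comm h1 h2)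
    rwa [map_mul, map_mul] at this
  yXyE h := by
    have := pr_eq_of_rel P (Rel.YXYE (by omega))
    rwa [map_mul, map_mul, map_mul, map_smul, mul_assoc, mul_assoc] at this
  EyXy h := by
    have := pr_eq_of_rel P (Rel.EYXY (by omega))
    rwa [map_mul, map_mul, map_mul, map_smul, mul_assoc] at this
  EyE h p := by
    have h1 := zpow_mem_span_of_pow_eq (u := (gens P).y) hk hq0 (Yg_pow_eq P) 0 p
    generalize ((((gens P).y ^ p : (Alg P)ˣ)) : Alg P) = z at h1 ⊢
    induction h1 using Submodule.span_induction with
    | mem z hz =>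
      obtain ⟨r, hr, hr', rfl⟩ := hz
      obtain ⟨m, rfl⟩ := Int.eq_ofNat_of_zero_le hr
      have := pr_eq_of_rel P (Rel.EYE (m := m) (by omega) (by omega))
      rw [map_mul, map_mul, map_smul, map_pow, mul_assoc] at this
      rw [zpow_natCast, Units.val_pow_eq_pow_val]
      exact ⟨_, this⟩
    | zero => exact ⟨0, by simp⟩
    | add x y _ _ hx hy =>
      obtain ⟨a, ha⟩ := hx
      obtain ⟨b, hb⟩ := hy
      exact ⟨a + b, by rw [add_mul, mul_add, ha, hb, add_smul]⟩
    | smul c x _ hx =>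
      obtain ⟨a, ha⟩ := hx
      exact ⟨c * a, by rw [smul_mul_assoc, mul_smul_comm, ha, smul_smul]⟩
  cyc p := by
    have h1 := zpow_mem_span_of_pow_eq (u := (gens P).y) hk hq0 (Yg_pow_eq P)
      (-((P.k : ℤ) - 1 - (P.k / 2 : ℕ))) p
    refine Submodule.span_mono ?_ h1
    rintro x ⟨r, h2, h3, rfl⟩
    exact ⟨r, h2, by omega, rfl⟩

theorem val_YU_gens {i : ℕ} (hi : 1 ≤ i) :
    ((gens P).YU i : Alg P) = Yp P i ∧ (↑((gens P).YU i)⁻¹ : Alg P) = YpInv P i := by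
  induction i, hi using Nat.le_induction with
  | base => constructor <;> simp [Yp, YpInv, downX, upX, downXi, upXi, Gens.YU_one, gens]
  | succ i hi ih =>
    obtain ⟨i, rfl⟩ := Nat.exists_eq_add_of_le' hi
    rw [(gens P).YU_succ hi, mul_inv_rev, mul_inv_rev]
    simp only [Units.val_mul, ih.1, ih.2]
    simp only [Yp, YpInv, Nat.add_sub_cancel, downX, upX, downXi, upXi, mul_assoc]
    exact ⟨rfl, rfl⟩

theorem Ypow_eq {i : ℕ} (hi : 1 ≤ i) (p : ℤ) :
    Ypow P i p = (((gens P).YU i ^ p : (Alg P)ˣ) : Alg P) := by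
  obtain ⟨h1, h2⟩ := val_YU_gens P hi
  unfold Ypow
  split_ifs with hp
  · obtain ⟨m, rfl⟩ := Int.eq_ofNat_of_zero_le hp
    simp [h1]
  · obtain ⟨m, hm⟩ := Int.eq_ofNat_of_zero_le (show 0 ≤ -p by omega)
    obtain rfl : p = -m := by omega
    simp [← h2]

theorem alpha_eq {i : ℕ} (hi : 1 ≤ i) (j l : ℕ) (p : ℤ) :
    alpha P i j l p = (gens P).al i j l p := by
  rw [alpha, Gens.al, Gens.bet, ← Ypow_eq P hi, mul_assoc, Gens.Xs, ← Units.coeHom_apply,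
    map_list_prod, List.map_map]
  rfl

theorem C_gens_le (m : ℕ) : (gens P).C R m ≤ Bsub P m := by
  refine Algebra.adjoin_mono ?_
  rintro x (⟨_, h⟩ | h)
  · exact Or.inl h
  · exact Or.inr h

theorem C_gens_eq {m : ℕ} (hm : 1 ≤ m) : (gens P).C R m = Bsub P m := by
  refine le_antisymm (C_gens_le P m) (Algebra.adjoin_mono ?_)
  rintro x (h | h)
  · exact Or.inl ⟨hm, h⟩
  · exact Or.inr h

theorem Bsub_mono {m m' : ℕ} (h : m ≤ m') : Bsub P m ≤ Bsub P m' := by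
  refine Algebra.adjoin_mono (Set.union_subset_union_right _ ?_)
  rintro x ⟨i, h1, h2, h3⟩
  exact ⟨i, h1, by omega, h3⟩

theorem EE_gens (m l : ℕ) : (gens P).EE m l = Echain P l m := by
  have hcons : ∀ m l, Echain P l (m + 1) = Eg P (l - 1) * Echain P (l - 2) m := by
    intro m
    induction m with
    | zero => intro l; simp [Echain]
    | succ m ih =>
      intro l
      rw [Echain, ih, Echain, mul_assoc]
      congr 3
      omega
  induction m generalizing l with
  | zero => rfl
  | succ m ih => rw [hcons, ← ih]; rfl

theorem alphaChainBar_cons (l i j : ℕ) (s : ℤ) (ii jj : ℕ → ℕ) (ss : ℕ → ℤ) (m : ℕ) :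
    alphaChainBar P l (fun t => if t = 1 then i else ii (t - 1))
      (fun t => if t = 1 then j else jj (t - 1)) (fun t => if t = 1 then s else ss (t - 1))
      (m + 1) = alpha P i j (l - 2) s * alphaChainBar P (l - 2) ii jj ss m := by
  induction m with
  | zero => simp [alphaChainBar]
  | succ m ih =>
    rw [alphaChainBar, ih, alphaChainBar, mul_assoc]
    congr 2
    simp
    congr 1
    omega

theorem mem_Vbar_of_mem_VB {m l b : ℕ} {v : Alg P}
    (hv : v ∈ (gens P).VB ((P.k : ℤ) - 1 - (P.k / 2 : ℕ)) (P.k / 2 : ℕ) m l b) :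
    ∃ ii jj : ℕ → ℕ, ∃ ss : ℕ → ℤ,
      (∀ t, 1 ≤ t → t ≤ m →
        1 ≤ ii t ∧ ii t ≤ jj t ∧ jj t ≤ l + 1 - 2 * t ∧ ss t ∈ Pset P.k) ∧
      (∀ t, 1 ≤ t → t + 1 ≤ m → ii (t + 1) < ii t) ∧ (1 ≤ m → ii 1 < b) ∧
      v = alphaChainBar P l ii jj ss m := by
  induction m generalizing l b v with
  | zero => exact ⟨fun _ => 0, fun _ => 0, fun _ => 0, by omega, by omega, by omega, hv⟩
  | succ m ih =>
    obtain ⟨i, j, s, v, hv, h1, h2, h3, h4, h5, h6, rfl⟩ := hv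
    obtain ⟨ii, jj, ss, h7, h8, h9, rfl⟩ := ih hv
    refine ⟨_, _, _, fun t ht ht' => ?_, fun t ht ht' => ?_, fun _ => ?_,
      (congrArg (· * _) (alpha_eq P h1 j (l - 2) s).symm).trans
        (alphaChainBar_cons P l i j s ii jj ss m).symm⟩
    · rcases ht.eq_or_lt with rfl | ht
      · simp only [if_true]
        exact ⟨h1, h3, by omega, by unfold Pset; constructor <;> omega⟩
      · simp only [show t ≠ 1 by omega, if_false]
        obtain ⟨h10, h11, h12, h13⟩ := h7 (t - 1) (by omega) (by omega)
        exact ⟨h10, h11, by omega, h13⟩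
    · simp only [show t + 1 ≠ 1 by omega, if_false, Nat.add_sub_cancel]
      rcases ht.eq_or_lt with rfl | ht
      · simpa using h9 (by omega)
      · simp only [show t ≠ 1 by omega, if_false]
        have := h8 (t - 1) (by omega) (by omega)
        rwa [Nat.sub_add_cancel (by omega)] at this
    · simpa using h2

theorem Vbar_subset_Bsub {m l : ℕ} (hm : 2 * m ≤ l) {v : Alg P} (hv : v ∈ Vbar P l m) :
    v ∈ Bsub P l := by
  obtain ⟨ii, jj, ss, h1, -, rfl⟩ := hv
  induction m with
  | zero => exact one_mem _
  | succ m ih =>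
    refine mul_mem (ih (by omega) fun t ht ht' => h1 t ht (by omega)) ?_
    obtain ⟨h2, h3, h4, -⟩ := h1 (m + 1) (by omega) le_rfl
    rw [alpha_eq P h2]
    exact C_gens_le P l (Gens.al_mem_C h2 h3 (by omega) (by omega) _)

theorem mul_Echain_mem (hk : 1 ≤ P.k) (hq0 : P.qc 0 = (P.q0 : R)) {m l : ℕ} (hm : 2 * m ≤ l)
    (hl : l ≤ P.n) {c : Alg P} (hc : c ∈ (gens P).C R l) :
    c * Echain P l m ∈ Submodule.span R {z : Alg P | ∃ v b, v ∈ Vbar P l m ∧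
      b ∈ (gens P).C R (l - 2 * m) ∧ z = v * Echain P l m * b} := by
  have h1 := (gens_isBMW P hk hq0).C_mul_EE_mem_W hm (by omega) c hc
  rw [EE_gens] at h1
  refine Submodule.span_mono ?_ h1
  rintro z ⟨v, hv, b, hb, rfl⟩
  obtain ⟨ii, jj, ss, h2, h3, -, h4⟩ := mem_Vbar_of_mem_VB P hv
  exact ⟨v, b, ⟨ii, jj, ss, h2, h3, h4⟩, hb, by rw [EE_gens]⟩

end Presentation

section AntiAutomorphism

variable {R A : Type*} [CommRing R] [Ring A] [Algebra R A] {st : A →ₗ[R] A}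

theorem star_mem_adjoin (hst1 : st 1 = 1)
    (hstmul : ∀ a b : A, st (a * b) = st b * st a) {S : Set A} (hS : ∀ x ∈ S, st x = x) {x : A}
    (hx : x ∈ Algebra.adjoin R S) : st x ∈ Algebra.adjoin R S := by
  induction hx using Algebra.adjoin_induction with
  | mem x hx => rw [hS x hx]; exact Algebra.subset_adjoin hx
  | algebraMap r =>
    rw [Algebra.algebraMap_eq_smul_one, map_smul, hst1]
    exact Subalgebra.smul_mem _ (one_mem _) r
  | add x y _ _ hx hy => rw [map_add]; exact add_mem hx hy
  | mul x y _ _ hx hy => rw [hstmul]; exact mul_mem hy hx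

theorem star_star (hst1 : st 1 = 1)
    (hstmul : ∀ a b : A, st (a * b) = st b * st a) {S : Set A} (hS : ∀ x ∈ S, st x = x) {x : A}
    (hx : x ∈ Algebra.adjoin R S) : st (st x) = x := by
  induction hx using Algebra.adjoin_induction with
  | mem x hx => rw [hS x hx, hS x hx]
  | algebraMap r =>
    rw [Algebra.algebraMap_eq_smul_one, map_smul, hst1, map_smul, hst1]
  | add x y _ _ hx hy => rw [map_add, map_add, hx, hy]
  | mul x y _ _ hx hy => rw [hstmul, hstmul, hx, hy]

end AntiAutomorphism

section Involution

variable {R : Type} [CommRing R] (P : Params R) {st : Alg P →ₗ[R] Alg P}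

theorem star_gen (hstY : st (Yg P) = Yg P) (hstYi : st (Ygi P) = Ygi P)
    (hstX : ∀ i, st (Xg P i) = Xg P i) (hstXi : ∀ i, st (Xgi P i) = Xgi P i)
    (hstE : ∀ i, st (Eg P i) = Eg P i) (l : ℕ) :
    ∀ x ∈ ({Yg P, Ygi P} ∪ {x | ∃ i, 1 ≤ i ∧ i + 1 ≤ l ∧
      (x = Xg P i ∨ x = Xgi P i ∨ x = Eg P i)} : Set (Alg P)), st x = x := by
  rintro x ((rfl | rfl) | ⟨i, -, -, rfl | rfl | rfl⟩)
  exacts [hstY, hstYi, hstX i, hstXi i, hstE i]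

theorem Echain_comm (hk : 1 ≤ P.k) (hq0 : P.qc 0 = (P.q0 : R)) {m l : ℕ} (hm : 2 * m < l)
    (hl : l ≤ P.n) {b : Alg P} (hb : b ∈ Bsub P (l - 2 * m)) :
    Commute (Echain P l m) b := by
  rw [← EE_gens]
  exact (gens_isBMW P hk hq0).EE_comm_C hm.le (by omega) b
    (by rwa [C_gens_eq P (by omega)])

theorem star_Echain (hk : 1 ≤ P.k) (hq0 : P.qc 0 = (P.q0 : R)) (hst1 : st 1 = 1)
    (hstmul : ∀ a b : Alg P, st (a * b) = st b * st a) (hstE : ∀ i, st (Eg P i) = Eg P i)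
    {m l : ℕ} (hm : 2 * m ≤ l) (hl : l ≤ P.n) : st (Echain P l m) = Echain P l m := by
  induction m with
  | zero => exact hst1
  | succ m ih =>
    rw [Echain, hstmul, hstE, ih (by omega)]
    refine (Echain_comm P hk hq0 (by omega) hl ?_).eq.symm
    exact Algebra.subset_adjoin (Or.inr ⟨_, by omega, by omega, Or.inr (Or.inr rfl)⟩)

/-- A product `x * E_{l,m} * y` with `x, y ∈ B_l` reduces to the spanning set of `I_{l,m}`. -/
theorem mul_Echain_mul_mem (hk : 1 ≤ P.k) (hq0 : P.qc 0 = (P.q0 : R)) (hst1 : st 1 = 1)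
    (hstmul : ∀ a b : Alg P, st (a * b) = st b * st a)
    (hstY : st (Yg P) = Yg P) (hstYi : st (Ygi P) = Ygi P)
    (hstX : ∀ i, st (Xg P i) = Xg P i) (hstXi : ∀ i, st (Xgi P i) = Xgi P i)
    (hstE : ∀ i, st (Eg P i) = Eg P i) {m l : ℕ} (hm : 2 * m ≤ l) (hl : l ≤ P.n) {x y : Alg P}
    (hx : x ∈ Bsub P l) (hy : y ∈ Bsub P l) :
    x * Echain P l m * y ∈ Submodule.span R
      {z : Alg P | ∃ v b w, v ∈ Vbar P l m ∧ b ∈ Bsub P (l - 2 * m) ∧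
        w ∈ Vbar P l m ∧ z = v * Echain P l m * b * st w} := by
  have hgen := star_gen P hstY hstYi hstX hstXi hstE
  rcases Nat.eq_zero_or_pos m with rfl | hm0
  · have h1 : (1 : Alg P) ∈ Vbar P l 0 :=
      ⟨fun _ => 0, fun _ => 0, fun _ => 0, by omega, by omega, rfl⟩
    exact Submodule.subset_span ⟨1, x * y, 1, h1, mul_mem hx hy, h1, by simp [Echain, hst1]⟩
  have hC : ∀ c ∈ (gens P).C R (l - 2 * m), Commute (Echain P l m) c := by
    rw [← EE_gens]
    exact (gens_isBMW P hk hq0).EE_comm_C hm (by omega)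
  have hCst : ∀ c ∈ (gens P).C R (l - 2 * m), st c ∈ (gens P).C R (l - 2 * m) := fun c hc =>
    star_mem_adjoin hst1 hstmul (by
      rintro x (⟨-, h⟩ | h)
      exacts [hgen 0 x (Or.inl h), hgen _ x (Or.inr h)]) hc
  have hCB : ∀ c, c ∈ Bsub P l → c ∈ (gens P).C R l := fun c hc => by
    rwa [C_gens_eq P (by omega)]
  have hleft := mul_Echain_mem P hk hq0 hm hl (hCB x hx)
  generalize x * Echain P l m = u at hleft ⊢
  induction hleft using Submodule.span_induction with
  | zero => rw [zero_mul]; exact Submodule.zero_mem _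
  | add a b _ _ ha hb => rw [add_mul]; exact Submodule.add_mem _ ha hb
  | smul r a _ ha => rw [smul_mul_assoc]; exact Submodule.smul_mem _ r ha
  | mem u hu =>
    obtain ⟨v, c, hv, hc, rfl⟩ := hu
    have hcy : c * y ∈ Bsub P l :=
      mul_mem (Bsub_mono P (by omega) (C_gens_le P _ hc)) hy
    have hright := mul_Echain_mem P hk hq0 hm hl
      (hCB _ (star_mem_adjoin hst1 hstmul (hgen l) hcy))
    have heq : v * Echain P l m * c * y = v * st (st (c * y) * Echain P l m) := by
      rw [hstmul, star_star hst1 hstmul (hgen l) hcy, star_Echain P hk hq0 hst1 hstmul hstE hm hl]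
      simp only [mul_assoc]
    rw [heq]
    generalize st (c * y) * Echain P l m = w at hright ⊢
    induction hright using Submodule.span_induction with
    | zero => rw [map_zero, mul_zero]; exact Submodule.zero_mem _
    | add a b _ _ ha hb => rw [map_add, mul_add]; exact Submodule.add_mem _ ha hb
    | smul r a _ ha => rw [map_smul, mul_smul_comm]; exact Submodule.smul_mem _ r ha
    | mem w hw =>
      obtain ⟨v', d, hv', hd, rfl⟩ := hw
      refine Submodule.subset_span ⟨v, st d, v', hv, C_gens_le P _ (hCst d hd), hv', ?_⟩
      rw [hstmul, hstmul, star_Echain P hk hq0 hst1 hstmul hstE hm hl, ← mul_assoc (st d),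
        ← (hC _ (hCst d hd)).eq]
      simp only [mul_assoc]

end Involution

end CBMW

/-- Lemma 12(a),(b) of the paper. With `*` the anti-automorphism
fixing the generators: (a) `I_{l,m} = V̄_{l,m} E_{l,m} B_{l-2m} V̄_{l,m}*` is a two-sided
ideal of `B_l`; (b) for `l ≥ 2m+2`,
`V̄_{l,m} E_{l,m} B_{l-2m} e_{l-2m-1} B_{l-2m} V̄_{l,m}* ⊆ I_{l,m+1}`. -/
theorem statement11 {R : Type} [CommRing R] (P : Params R)
    (hn : 1 ≤ P.n) (hk : 1 ≤ P.k) (hq0 : P.qc 0 = (P.q0 : R))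
    (hcomp : (P.lam : R) - P.laminv = P.delta * (1 - P.A 0))
    (st : Alg P →ₗ[R] Alg P) (hst1 : st 1 = 1)
    (hstmul : ∀ a b : Alg P, st (a * b) = st b * st a)
    (hstY : st (Yg P) = Yg P) (hstYi : st (Ygi P) = Ygi P)
    (hstX : ∀ i, st (Xg P i) = Xg P i) (hstXi : ∀ i, st (Xgi P i) = Xgi P i)
    (hstE : ∀ i, st (Eg P i) = Eg P i)
    (m l : ℕ) (hml : 2 * m ≤ l) (hln : l ≤ P.n) :
    (∀ x ∈ Bsub P l,
      ∀ y ∈ Submodule.span R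
          {z : Alg P | ∃ v b w, v ∈ Vbar P l m ∧ b ∈ Bsub P (l - 2 * m) ∧
            w ∈ Vbar P l m ∧ z = v * Echain P l m * b * st w},
        x * y ∈ Submodule.span R
            {z : Alg P | ∃ v b w, v ∈ Vbar P l m ∧ b ∈ Bsub P (l - 2 * m) ∧
              w ∈ Vbar P l m ∧ z = v * Echain P l m * b * st w} ∧
        y * x ∈ Submodule.span R
            {z : Alg P | ∃ v b w, v ∈ Vbar P l m ∧ b ∈ Bsub P (l - 2 * m) ∧
              w ∈ Vbar P l m ∧ z = v * Echain P l m * b * st w}) ∧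
    (2 * m + 2 ≤ l →
      Submodule.span R
          {z : Alg P | ∃ v b b' w, v ∈ Vbar P l m ∧ b ∈ Bsub P (l - 2 * m) ∧
            b' ∈ Bsub P (l - 2 * m) ∧ w ∈ Vbar P l m ∧
            z = v * Echain P l m * b * Eg P (l - 2 * m - 1) * b' * st w}
        ≤ Submodule.span R
            {z : Alg P | ∃ v b w, v ∈ Vbar P l (m + 1) ∧ b ∈ Bsub P (l - 2 * (m + 1)) ∧
              w ∈ Vbar P l (m + 1) ∧ z = v * Echain P l (m + 1) * b * st w}) := by
  have hgen := star_gen P hstY hstYi hstX hstXi hstE l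
  have hred := fun {m : ℕ} (hm : 2 * m ≤ l) {x y : Alg P} (hx : x ∈ Bsub P l)
    (hy : y ∈ Bsub P l) =>
    mul_Echain_mul_mem P hk hq0 hst1 hstmul hstY hstYi hstX hstXi hstE hm hln hx hy
  have hstV : ∀ w ∈ Vbar P l m, st w ∈ Bsub P l := fun w hw =>
    star_mem_adjoin hst1 hstmul hgen (Vbar_subset_Bsub P hml hw)
  have hsub := Bsub_mono P (Nat.sub_le l (2 * m))
  refine ⟨fun x hx y hy => ?_, fun hml' => Submodule.span_le.2 ?_⟩
  · induction hy using Submodule.span_induction with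
    | zero => rw [mul_zero, zero_mul]; exact ⟨Submodule.zero_mem _, Submodule.zero_mem _⟩
    | add a b _ _ ha hb =>
      rw [mul_add, add_mul]
      exact ⟨Submodule.add_mem _ ha.1 hb.1, Submodule.add_mem _ ha.2 hb.2⟩
    | smul r a _ ha =>
      rw [mul_smul_comm, smul_mul_assoc]
      exact ⟨Submodule.smul_mem _ r ha.1, Submodule.smul_mem _ r ha.2⟩
    | mem y hy =>
      obtain ⟨v, b, w, hv, hb, hw, rfl⟩ := hy
      have hv := Vbar_subset_Bsub P hml hv
      have hbw := mul_mem (hsub hb) (hstV w hw)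
      constructor
      · simpa only [mul_assoc] using hred hml (mul_mem hx hv) hbw
      · simpa only [mul_assoc] using hred hml hv (mul_mem hbw hx)
  · rintro z ⟨v, b, b', w, hv, hb, hb', hw, rfl⟩
    have hE : Echain P l (m + 1) = Echain P l m * Eg P (l - 2 * m - 1) :=
      congrArg (Echain P l m * Eg P ·) (by omega)
    have heq : v * Echain P l m * b * Eg P (l - 2 * m - 1) * b' * st w =
        v * b * Echain P l (m + 1) * (b' * st w) := by
      rw [mul_assoc v, (Echain_comm P hk hq0 (by omega) hln hb).eq, hE]
      simp only [mul_assoc]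
    rw [heq]
    exact hred (by omega) (mul_mem (Vbar_subset_Bsub P hml hv) (hsub hb))
      (mul_mem (hsub hb') (hstV w hw))
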